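/- Let U be a simple finite-dimensional module for D(Λ,L) on which the central operators d_i(1,−ε_i) act as scalars λ_i·Id with λ = (λ_1,…,λ_m) ≠ 0 and d_0(1,0) acts as λ_0·Id. Then there exists a finite-dimensional irreducible gl(m,n)-module (V,ρ) such that U ≅ Λ ⊗ V, and the L-action integrates to the action of (A#V)_0 on Λ ⊗ V given by D_j(f,s) = λ_j f ⊗ Id_V + Σ_{i=1}^m s_i f ⊗ ρ(e_{ij}) + Σ_{α=1}^n (f)∂*_α ⊗ ρ(e_{αj}), Δ_β(f,s) = f ∂/∂ξ_β ⊗ Id_V + Σ_{i=1}^m s_i f ⊗ ρ(e_{iβ}) + Σ_{α=1}^n (f)∂*_α ⊗ ρ(e_{αβ}), and D_0(f,s) = λ_0 f ⊗ Id_V. -/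

import Mathlib

open scoped BigOperators

namespace WSuper

noncomputable section

/-- Exponents of the Laurent (even) variables `t_1, …, t_m`. -/
abbrev LExp (m : ℕ) := Fin m → ℤ
/-- Exponents of the Grassmann (odd) variables `ξ_1, …, ξ_n`. -/
abbrev GExp (n : ℕ) := Fin n → Bool

variable {m n : ℕ}

/-- Degree of a Grassmann monomial `ξ^s`. -/
def gdeg (s : GExp n) : ℕ := (Finset.univ.filter fun a => s a = true).card

/-- Number of inversions between `ξ^s` and `ξ^q`. -/
def invCount (s q : GExp n) : ℕ :=
  ((Finset.univ ×ˢ Finset.univ).filter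
    fun p : Fin n × Fin n => s p.1 = true ∧ q p.2 = true ∧ p.2 < p.1).card

/-- The scalar `c` with `ξ^s · ξ^q = c · ξ^(s xor q)` in the exterior algebra. -/
def mulSgn (s q : GExp n) : ℂ :=
  if ∃ a, s a = true ∧ q a = true then 0 else (-1 : ℂ) ^ invCount s q

/-- Exponent of the product of two (disjoint) Grassmann monomials. -/
def xorE (s q : GExp n) : GExp n := fun a => Bool.xor (s a) (q a)

/-- The scalar `c` with `∂_a (ξ^s) = c ξ^(s \ a)`. -/
def derC (a : Fin n) (s : GExp n) : ℂ :=
  if s a = true then (-1 : ℂ) ^ (Finset.univ.filter fun x => s x = true ∧ x < a).card else 0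

/-- The exponent of `∂_a (ξ^s)`. -/
def derE (a : Fin n) (s : GExp n) : GExp n := Function.update s a false

/-- Directions: `d_i = t_i ∂/∂t_i`, `∂_α = ∂/∂ξ_α`, and (when `b = true`) the extra
even direction `d_0` of `W(m,n) ⋉ A d_0`. -/
inductive Dir (m n : ℕ) : Bool → Type where
  | di {b : Bool} (i : Fin m) : Dir m n b
  | pa {b : Bool} (a : Fin n) : Dir m n b
  | d0 : Dir m n true

/-- The basis `t^r ξ^s D` of `W(m,n)` (for `b = false`) resp. of `W(m,n) ⋉ A d_0`
(for `b = true`). -/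
abbrev WBasis (m n : ℕ) (b : Bool) := LExp m × GExp n × Dir m n b

/-- The Lie superalgebra `W(m,n)` (`b = false`) resp. `W(m,n) ⋉ A d_0` (`b = true`),
as the free complex vector space on its standard basis. -/
abbrev W (m n : ℕ) (b : Bool) := WBasis m n b →₀ ℂ

def sng {b : Bool} (x : WBasis m n b) : W m n b := Finsupp.single x 1

/-- Parity (0 = even, 1 = odd) of a basis element. -/
def par {b : Bool} : WBasis m n b → ℕ
  | ⟨_, s, .di _⟩ => gdeg s % 2
  | ⟨_, s, .pa _⟩ => (gdeg s + 1) % 2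
  | ⟨_, s, .d0⟩ => gdeg s % 2

/-- The super Lie bracket of `W(m,n)` (resp. `W(m,n) ⋉ A d_0`) on basis elements. -/
def brB {b : Bool} : WBasis m n b → WBasis m n b → W m n b
  | ⟨r, s, .di i⟩, ⟨p, q, .di j⟩ =>
      ((p i : ℂ) * mulSgn s q) • sng ⟨r + p, xorE s q, .di j⟩
        - ((r j : ℂ) * mulSgn s q) • sng ⟨r + p, xorE s q, .di i⟩
  | ⟨r, s, .di i⟩, ⟨p, q, .pa β⟩ =>
      ((p i : ℂ) * mulSgn s q) • sng ⟨r + p, xorE s q, .pa β⟩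
        - ((-1 : ℂ) ^ (gdeg s * (gdeg q + 1)) * derC β s * mulSgn q (derE β s)) •
            sng ⟨r + p, xorE q (derE β s), .di i⟩
  | ⟨r, s, .pa α⟩, ⟨p, q, .di j⟩ =>
      (derC α q * mulSgn s (derE α q)) • sng ⟨r + p, xorE s (derE α q), .di j⟩
        - ((-1 : ℂ) ^ ((gdeg s + 1) * gdeg q) * (r j : ℂ) * mulSgn q s) •
            sng ⟨r + p, xorE q s, .pa α⟩
  | ⟨r, s, .pa α⟩, ⟨p, q, .pa β⟩ =>
      (derC α q * mulSgn s (derE α q)) • sng ⟨r + p, xorE s (derE α q), .pa β⟩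
        - ((-1 : ℂ) ^ ((gdeg s + 1) * (gdeg q + 1)) * derC β s * mulSgn q (derE β s)) •
            sng ⟨r + p, xorE q (derE β s), .pa α⟩
  | ⟨r, s, .di i⟩, ⟨p, q, .d0⟩ =>
      ((p i : ℂ) * mulSgn s q) • sng ⟨r + p, xorE s q, .d0⟩
  | ⟨r, s, .pa α⟩, ⟨p, q, .d0⟩ =>
      (derC α q * mulSgn s (derE α q)) • sng ⟨r + p, xorE s (derE α q), .d0⟩
  | ⟨r, s, .d0⟩, ⟨p, q, .di j⟩ =>
      (-(r j : ℂ) * mulSgn s q) • sng ⟨r + p, xorE s q, .d0⟩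
  | ⟨r, s, .d0⟩, ⟨p, q, .pa β⟩ =>
      (-(-1 : ℂ) ^ (gdeg s * (gdeg q + 1)) * derC β s * mulSgn q (derE β s)) •
          sng ⟨r + p, xorE q (derE β s), .d0⟩
  | ⟨_, _, .d0⟩, ⟨_, _, .d0⟩ => 0

/-- A module over the Lie superalgebra `W(m,n)` (resp. `W(m,n) ⋉ A d_0`):
a complex vector space with a linear action satisfying the super commutator rule. -/
structure WRep (m n : ℕ) (b : Bool) where
  M : Type
  [addgrp : AddCommGroup M]
  [mods : Module ℂ M]
  act : W m n b →ₗ[ℂ] M →ₗ[ℂ] M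
  super : ∀ x y : WBasis m n b,
    act (brB x y)
      = act (sng x) ∘ₗ act (sng y)
        - ((-1 : ℂ) ^ (par x * par y)) • (act (sng y) ∘ₗ act (sng x))

attribute [instance] WRep.addgrp WRep.mods

/-- A raw action of (the basis of) `W(m,n)` resp. `W(m,n) ⋉ A d_0` on a vector space. -/
abbrev GAct (m n : ℕ) (b : Bool) (M : Type) [AddCommGroup M] [Module ℂ M] :=
  WBasis m n b → M →ₗ[ℂ] M

/-- Index set for the Cartan subalgebra `h'`: the elements `d_1, …, d_m`,
together with `d_0` when `b = true`. -/
abbrev HIdx (m : ℕ) (b : Bool) := Fin m ⊕ Fin (cond b 1 0)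

def hB (m n : ℕ) (b : Bool) : HIdx m b → WBasis m n b :=
  fun h => match b, h with
    | _, .inl i => ⟨0, fun _ => false, .di i⟩
    | true, .inr _ => ⟨0, fun _ => false, .d0⟩
    | false, .inr j => j.elim0

/-- The basis element `ξ_a ∂_a` of the odd Cartan subalgebra `h''`. -/
def hppB (m n : ℕ) (b : Bool) (a : Fin n) : WBasis m n b :=
  ⟨0, fun x => decide (x = a), .pa a⟩

section Predicates

variable {M : Type} [AddCommGroup M] [Module ℂ M] {b : Bool}

/-- Weight space with respect to the even Cartan subalgebra `h'`. -/
def wtG (F : GAct m n b M) (lam : HIdx m b → ℂ) : Submodule ℂ M :=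
  ⨅ h, LinearMap.ker (F (hB m n b h) - lam h • (LinearMap.id : M →ₗ[ℂ] M))

/-- Weight space with respect to the full Cartan subalgebra `h = h' ⊕ h''`. -/
def wtFullG (F : GAct m n b M) (lam : HIdx m b → ℂ) (mu : Fin n → ℂ) : Submodule ℂ M :=
  wtG F lam ⊓
    ⨅ a, LinearMap.ker (F (hppB m n b a) - mu a • (LinearMap.id : M →ₗ[ℂ] M))

/-- Strong Harish-Chandra module: weight decomposition with respect to `h'`
with finite-dimensional weight spaces. -/
def IsStrongHCG (F : GAct m n b M) : Prop :=
  (⨆ lam, wtG F lam) = ⊤ ∧ ∀ lam, FiniteDimensional ℂ (wtG F lam)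

/-- Harish-Chandra module: weight decomposition with respect to `h`
with finite-dimensional weight spaces. -/
def IsHCG (F : GAct m n b M) : Prop :=
  (⨆ lam, ⨆ mu, wtFullG F lam mu) = ⊤ ∧
    ∀ lam mu, FiniteDimensional ℂ (wtFullG F lam mu)

/-- Strongly cuspidal: strong Harish-Chandra with uniformly bounded multiplicities. -/
def IsStronglyCuspidalG (F : GAct m n b M) : Prop :=
  IsStrongHCG F ∧ ∃ C : ℕ, ∀ lam, Module.finrank ℂ (wtG F lam) ≤ C

/-- Cuspidal: Harish-Chandra with uniformly bounded weight multiplicities. -/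
def IsCuspidalG (F : GAct m n b M) : Prop :=
  IsHCG F ∧ ∃ C : ℕ, ∀ lam mu, Module.finrank ℂ (wtFullG F lam mu) ≤ C

/-- The action of the odd Cartan subalgebra `h''` is diagonalizable. -/
def DiagHppG (F : GAct m n b M) : Prop :=
  (⨆ mu : Fin n → ℂ,
    ⨅ a, LinearMap.ker (F (hppB m n b a) - mu a • (LinearMap.id : M →ₗ[ℂ] M))) = ⊤

def InvariantG (F : GAct m n b M) (N : Submodule ℂ M) : Prop :=
  ∀ x : WBasis m n b, ∀ v ∈ N, F x v ∈ N

/-- Simplicity of a module, phrased via invariant subspaces. -/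
def IsSimpleG (F : GAct m n b M) : Prop :=
  (∃ v : M, v ≠ 0) ∧ ∀ N : Submodule ℂ M, InvariantG F N → N = ⊥ ∨ N = ⊤

end Predicates

/-- The action of basis elements attached to a representation. -/
def WRep.g {b : Bool} (ρ : WRep m n b) : GAct m n b ρ.M := fun x => ρ.act (sng x)

end

end WSuper

namespace WSuper

noncomputable section

variable {m n : ℕ}

/-- Basis monomials `t^r ξ^s` of the supercommutative superalgebra `A = R_m ⊗ Λ`. -/
abbrev ABasis (m n : ℕ) := LExp m × GExp n

/-- The supercommutative superalgebra `A = R_m ⊗ Λ` as the free complex vector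
space on its monomial basis. -/
abbrev AAlg (m n : ℕ) := ABasis m n →₀ ℂ

def asng (x : ABasis m n) : AAlg m n := Finsupp.single x 1

def aone (m n : ℕ) : AAlg m n := asng (0, fun _ => false)

/-- Product of two monomials of `A`. -/
def amulB (x y : ABasis m n) : AAlg m n :=
  mulSgn x.2 y.2 • asng (x.1 + y.1, xorE x.2 y.2)

/-- Parity of a monomial of `A`. -/
def apar (x : ABasis m n) : ℕ := gdeg x.2 % 2

/-- The action of a basis element of `W(m,n)` (resp. `W(m,n) ⋉ A d_0`) on a
monomial of `A` by superderivations (`d_0` acts by zero on `A`). -/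
def wOnA {b : Bool} : WBasis m n b → ABasis m n → AAlg m n
  | ⟨r, s, .di i⟩, ⟨p, q⟩ => ((p i : ℂ) * mulSgn s q) • asng (r + p, xorE s q)
  | ⟨r, s, .pa α⟩, ⟨p, q⟩ =>
      (derC α q * mulSgn s (derE α q)) • asng (r + p, xorE s (derE α q))
  | ⟨_, _, .d0⟩, _ => 0

/-- An `AV`-module: compatible actions of the superalgebra `A` and of the Lie
superalgebra `V = W(m,n)` (resp. `W(m,n) ⋉ A d_0`), satisfying the Leibniz rule. -/
structure AVRep (m n : ℕ) (b : Bool) extends WRep m n b where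
  aact : AAlg m n →ₗ[ℂ] M →ₗ[ℂ] M
  aact_one : aact (aone m n) = LinearMap.id
  aact_mul : ∀ x y : ABasis m n, aact (amulB x y) = aact (asng x) ∘ₗ aact (asng y)
  leibniz : ∀ (x : WBasis m n b) (f : ABasis m n),
    act (sng x) ∘ₗ aact (asng f)
      = aact (wOnA x f)
        + ((-1 : ℂ) ^ (par x * apar f)) • (aact (asng f) ∘ₗ act (sng x))

/-- `M` is finitely generated as an `A`-module. -/
def IsFiniteRank {b : Bool} (ρ : AVRep m n b) : Prop :=
  ∃ S : Finset ρ.M,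
    Submodule.span ℂ {v : ρ.M | ∃ f : ABasis m n, ∃ s ∈ S, v = ρ.aact (asng f) s} = ⊤

/-- A subspace invariant under both the `A`-action and the `V`-action. -/
def AVInvariant {b : Bool} (ρ : AVRep m n b) (N : Submodule ℂ ρ.M) : Prop :=
  InvariantG ρ.g N ∧ ∀ f : ABasis m n, ∀ v ∈ N, ρ.aact (asng f) v ∈ N

/-- Irreducibility as an `AV`-module. -/
def AVIsSimple {b : Bool} (ρ : AVRep m n b) : Prop :=
  (∃ v : ρ.M, v ≠ 0) ∧ ∀ N : Submodule ℂ ρ.M, AVInvariant ρ N → N = ⊥ ∨ N = ⊤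

/-- A weight module: weight decomposition with respect to `h'`. -/
def IsWeightG {M : Type} [AddCommGroup M] [Module ℂ M] {b : Bool}
    (F : GAct m n b M) : Prop :=
  (⨆ lam, wtG F lam) = ⊤

end

end WSuper

namespace WSuper

noncomputable section

variable {m n : ℕ}

/-- Index set for the standard basis `e_{xy}` of `gl(m,n)`. -/
abbrev GlIdx (m n : ℕ) := Fin m ⊕ Fin n

/-- Parity of an index of `gl(m,n)`. -/
def gpar : GlIdx m n → ℕ
  | .inl _ => 0
  | .inr _ => 1

/-- A module over the Lie superalgebra `gl(m,n)`, given by the action of the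
standard basis elements `e_{xy}` subject to the super commutator relations. -/
structure GlRep (m n : ℕ) where
  V : Type
  [addgrp : AddCommGroup V]
  [mods : Module ℂ V]
  ρ : GlIdx m n → GlIdx m n → Module.End ℂ V
  rel : ∀ x y z w : GlIdx m n,
    ρ x y * ρ z w
        - ((-1 : ℂ) ^ ((gpar x + gpar y) * (gpar z + gpar w))) • (ρ z w * ρ x y)
      = (if y = z then ρ x w else 0)
        - ((-1 : ℂ) ^ ((gpar x + gpar y) * (gpar z + gpar w))) •
            (if w = x then ρ z y else 0)

attribute [instance] GlRep.addgrp GlRep.mods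

/-- Irreducibility of a `gl(m,n)`-module. -/
def GlRep.IsSimple (σ : GlRep m n) : Prop :=
  (∃ v : σ.V, v ≠ 0) ∧
    ∀ N : Submodule ℂ σ.V, (∀ x y, ∀ v ∈ N, σ.ρ x y v ∈ N) → N = ⊥ ∨ N = ⊤

/-- The carrier `A ⊗ V` of a tensor module. -/
abbrev TModule (σ : GlRep m n) := ABasis m n →₀ σ.V

/-- The action of `W(m,n)` (resp. `W(m,n) ⋉ A d_0`, where `f d_0` acts as
multiplication by `λ_0 f`) on the tensor module `T(V, λ) = A ⊗ V`:
`(t^s f d_j)(t^r g ⊗ v) = (r_j + λ_j) t^{r+s} f g ⊗ v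
  + Σ_i s_i t^{r+s} f ⊗ ρ(e_{ij}) g·v + Σ_α t^{r+s} (f)∂*_α ⊗ ρ(e_{αj}) g·v`,
`(t^s f ∂_β)(t^r g ⊗ v) = t^{r+s} f (∂g/∂ξ_β) ⊗ v
  + Σ_i s_i t^{r+s} f ⊗ ρ(e_{iβ}) g·v + Σ_α t^{r+s} (f)∂*_α ⊗ ρ(e_{αβ}) g·v`,
with `(f)∂*_α = (−1)^{|f|+1} ∂_α(f)` and the usual Koszul signs for applying an
operator `a ⊗ ρ(e)` with `e` odd to `g ⊗ v`. -/
def tmAct (σ : GlRep m n) (lam : Fin m → ℂ) (lam0 : ℂ) {b : Bool} :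
    WBasis m n b → TModule σ → TModule σ
  | ⟨s, f, .di j⟩, u => u.sum fun rc v =>
      ((((rc.1 j : ℂ) + lam j) * mulSgn f rc.2) •
          Finsupp.single (rc.1 + s, xorE f rc.2) v)
      + (∑ i : Fin m, ((s i : ℂ) * mulSgn f rc.2) •
          Finsupp.single (rc.1 + s, xorE f rc.2) (σ.ρ (.inl i) (.inl j) v))
      + (∑ α : Fin n,
          ((-1 : ℂ) ^ gdeg rc.2 * ((-1 : ℂ) ^ (gdeg f + 1) * derC α f) *
              mulSgn (derE α f) rc.2) •
            Finsupp.single (rc.1 + s, xorE (derE α f) rc.2) (σ.ρ (.inr α) (.inl j) v))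
  | ⟨s, f, .pa β⟩, u => u.sum fun rc v =>
      ((derC β rc.2 * mulSgn f (derE β rc.2)) •
          Finsupp.single (rc.1 + s, xorE f (derE β rc.2)) v)
      + (∑ i : Fin m, ((-1 : ℂ) ^ gdeg rc.2 * (s i : ℂ) * mulSgn f rc.2) •
          Finsupp.single (rc.1 + s, xorE f rc.2) (σ.ρ (.inl i) (.inr β) v))
      + (∑ α : Fin n,
          (((-1 : ℂ) ^ (gdeg f + 1) * derC α f) * mulSgn (derE α f) rc.2) •
            Finsupp.single (rc.1 + s, xorE (derE α f) rc.2) (σ.ρ (.inr α) (.inr β) v))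
  | ⟨s, f, .d0⟩, u => u.sum fun rc v =>
      (lam0 * mulSgn f rc.2) • Finsupp.single (rc.1 + s, xorE f rc.2) v

/-- The action of `A` on the tensor module `A ⊗ V` by multiplication on the
left tensor factor. -/
def tmA {σ : GlRep m n} (x : ABasis m n) (u : TModule σ) : TModule σ :=
  u.sum fun rc v => mulSgn x.2 rc.2 • Finsupp.single (x.1 + rc.1, xorE x.2 rc.2) v

end

end WSuper

namespace WSuper

noncomputable section

variable {m n : ℕ}

/-- The exterior algebra `Λ = Λ(ξ_1,…,ξ_n)` as free vector space on monomials. -/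
abbrev LamAlg (n : ℕ) := GExp n →₀ ℂ

def lm (s : GExp n) : LamAlg n := Finsupp.single s 1

/-- Product in `Λ`. -/
def lmul (f g : LamAlg n) : LamAlg n :=
  f.sum fun s a => g.sum fun q c => (a * c * mulSgn s q) • lm (xorE s q)

/-- The derivation `∂_α` of `Λ`. -/
def pdL (α : Fin n) (f : LamAlg n) : LamAlg n :=
  f.sum fun s a => (a * derC α s) • lm (derE α s)

/-- The right derivation `(f)∂*_β = (−1)^{|f|+1} ∂_β(f)` of `Λ`. -/
def rdL (β : Fin n) (f : LamAlg n) : LamAlg n :=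
  f.sum fun s a => (a * (-1 : ℂ) ^ (gdeg s + 1) * derC β s) • lm (derE β s)

/-- The shift `ε_i` occurring in the second argument of `d_i(f, k − ε_i)`. -/
def dsh {b : Bool} (D : Dir m n b) (j : Fin m) : ℤ :=
  match D with
  | .di i => if j = i then 1 else 0
  | _ => 0

/-- `ε_i` as an integer vector. -/
def epsZ (i : Fin m) : Fin m → ℤ := fun j => if j = i then 1 else 0

/-- `ε_j` as a natural-number vector. -/
def natE (j : Fin m) : Fin m → ℕ := fun x => if x = j then 1 else 0

/-- The trivial Grassmann exponent (the monomial `1`). -/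
def gl0 {n : ℕ} : GExp n := fun _ => false

/-- The Grassmann exponent of the single variable `ξ_β`. -/
def gOne (β : Fin n) : GExp n := fun x => decide (x = β)

/-- Basis of the jet Lie superalgebra `L`: the element `(a, s, kk, D)` represents
`ξ^a D(ξ^s, kk − ε_i)` for `D = d_i`, resp. `ξ^a ∂_α(ξ^s, kk)`, `ξ^a d_0(ξ^s, kk)`;
here `kk ∈ ℤ_+^m`. -/
abbrev LBasis (m n : ℕ) (b : Bool) := GExp n × GExp n × (Fin m → ℕ) × Dir m n b

/-- The jet Lie superalgebra `L`, as free complex vector space on its basis. -/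
abbrev LAlg (m n : ℕ) (b : Bool) := LBasis m n b →₀ ℂ

def lsng {b : Bool} (x : LBasis m n b) : LAlg m n b := Finsupp.single x 1

/-- Parity of a basis element of `L`. -/
def lpar {b : Bool} : LBasis m n b → ℕ
  | ⟨a, s, _, .di _⟩ => (gdeg a + gdeg s) % 2
  | ⟨a, s, _, .pa _⟩ => (gdeg a + gdeg s + 1) % 2
  | ⟨a, s, _, .d0⟩ => (gdeg a + gdeg s) % 2

/-- The actual (shifted) integer label of a generator of `L`. -/
def zOf {b : Bool} (kk : Fin m → ℕ) (D : Dir m n b) : Fin m → ℤ :=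
  fun i => (kk i : ℤ) - dsh D i

/-- The generator `D(ξ^s, k)` of `L` with integer label `k` (zero if the label is
out of range). -/
def mkL {b : Bool} (a s : GExp n) (k : Fin m → ℤ) (D : Dir m n b) : LAlg m n b :=
  if ∀ i, 0 ≤ k i + dsh D i then
    Finsupp.single (a, s, fun i => (k i + dsh D i).toNat, D) 1
  else 0

/-- Left multiplication of an element of `L` by an element of `Λ` (on the first
Grassmann slot). -/
def lmulL {b : Bool} (h : LamAlg n) (z : LAlg m n b) : LAlg m n b :=
  h.sum fun e c => z.sum fun bz cz =>
    (c * cz * mulSgn e bz.1) • Finsupp.single (xorE e bz.1, bz.2.1, bz.2.2.1, bz.2.2.2) 1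

/-- The `Λ`-valued bracket `[D(ξ^s,k), ξ^c]` of a generator of `L` with a
Grassmann monomial (relations (R7)–(R9)). -/
def genOnL {b : Bool} : (GExp n × (Fin m → ℕ) × Dir m n b) → GExp n → LamAlg n
  | ⟨s, kk, .pa α⟩, c =>
      if kk = 0 then (derC α c * mulSgn s (derE α c)) • lm (xorE s (derE α c)) else 0
  | ⟨_, _, .di _⟩, _ => 0
  | ⟨_, _, .d0⟩, _ => 0

/-- The bracket of two generators of `L` (with trivial left Grassmann factor),
given by relations (R1)–(R6) and the `d_0`-relations. -/
def genBr {b : Bool} :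
    (GExp n × (Fin m → ℕ) × Dir m n b) → (GExp n × (Fin m → ℕ) × Dir m n b) →
      LAlg m n b
  | ⟨s, kk, .di i⟩, ⟨q, kk', .di j⟩ =>
      let l := zOf kk (.di i : Dir m n b)
      let k := zOf kk' (.di j : Dir m n b)
      if kk = 0 ∧ kk' = 0 then 0
      else if kk = 0 then
        ((k i : ℂ) + if i = j then 1 else 0) •
          (mulSgn s q • mkL gl0 (xorE s q) (k - epsZ i) (.di j)
            - mkL s q (k - epsZ i) (.di j))
      else if kk' = 0 then
        (-(-1 : ℂ) ^ (gdeg s * gdeg q)) •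
          (((l j : ℂ) + if i = j then 1 else 0) •
            (mulSgn q s • mkL gl0 (xorE q s) (l - epsZ j) (.di i)
              - mkL q s (l - epsZ j) (.di i)))
      else
        (k i : ℂ) • (mulSgn s q • mkL gl0 (xorE s q) (l + k) (.di j))
          - (l j : ℂ) • (mulSgn s q • mkL gl0 (xorE s q) (l + k) (.di i))
  | ⟨s, kk, .di i⟩, ⟨q, kk', .pa α⟩ =>
      let l := zOf kk (.di i : Dir m n b)
      let k := zOf kk' (.pa α : Dir m n b)
      if kk = 0 then
        (k i : ℂ) • (mulSgn s q • mkL gl0 (xorE s q) (k - epsZ i) (.pa α)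
            - mkL s q (k - epsZ i) (.pa α))
          - ((-1 : ℂ) ^ (gdeg s + gdeg q) * derC α s * mulSgn (derE α s) q) •
              mkL gl0 (xorE (derE α s) q) (k - epsZ i) (.di i)
      else
        (k i : ℂ) • (mulSgn s q • mkL gl0 (xorE s q) (l + k) (.pa α))
          - ((-1 : ℂ) ^ (gdeg s + gdeg q) * derC α s * mulSgn (derE α s) q) •
              mkL gl0 (xorE (derE α s) q) (l + k) (.di i)
  | ⟨s, kk, .pa α⟩, ⟨q, kk', .di i⟩ =>
      let l := zOf kk (.pa α : Dir m n b)
      let k := zOf kk' (.di i : Dir m n b)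
      if kk' = 0 then
        (-(-1 : ℂ) ^ ((gdeg s + 1) * gdeg q)) •
          ((l i : ℂ) • (mulSgn q s • mkL gl0 (xorE q s) (l - epsZ i) (.pa α)
              - mkL q s (l - epsZ i) (.pa α))
            - ((-1 : ℂ) ^ (gdeg q + gdeg s) * derC α q * mulSgn (derE α q) s) •
                mkL gl0 (xorE (derE α q) s) (l - epsZ i) (.di i))
      else
        (-(-1 : ℂ) ^ ((gdeg s + 1) * gdeg q)) •
          ((l i : ℂ) • (mulSgn q s • mkL gl0 (xorE q s) (l + k) (.pa α))
            - ((-1 : ℂ) ^ (gdeg q + gdeg s) * derC α q * mulSgn (derE α q) s) •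
                mkL gl0 (xorE (derE α q) s) (l + k) (.di i))
  | ⟨s, kk, .pa α⟩, ⟨q, kk', .pa β⟩ =>
      (derC α q * mulSgn s (derE α q)) •
          mkL gl0 (xorE s (derE α q)) (zOf kk (.pa α : Dir m n b) + zOf kk' (.pa β : Dir m n b)) (.pa β)
        - ((-1 : ℂ) ^ (gdeg s + 1) * derC β s * mulSgn (derE β s) q) •
            mkL gl0 (xorE (derE β s) q) (zOf kk (.pa α : Dir m n b) + zOf kk' (.pa β : Dir m n b)) (.pa α)
  | ⟨s, kk, .di i⟩, ⟨q, kk', .d0⟩ =>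
      let l := zOf kk (.di i : Dir m n true)
      let k := zOf kk' (.d0 : Dir m n true)
      if kk = 0 then
        (k i : ℂ) • (mulSgn s q • mkL gl0 (xorE s q) (k - epsZ i) .d0
          - mkL s q (k - epsZ i) .d0)
      else (k i : ℂ) • (mulSgn s q • mkL gl0 (xorE s q) (l + k) .d0)
  | ⟨s, kk, .pa α⟩, ⟨q, kk', .d0⟩ =>
      (derC α q * mulSgn s (derE α q)) •
        mkL gl0 (xorE s (derE α q)) (zOf kk (.pa α : Dir m n true) + zOf kk' (.d0 : Dir m n true)) .d0
  | ⟨s, kk, .d0⟩, ⟨q, kk', .di j⟩ =>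
      let l := zOf kk (.d0 : Dir m n true)
      let k := zOf kk' (.di j : Dir m n true)
      if kk' = 0 then
        (-(-1 : ℂ) ^ (gdeg s * gdeg q)) •
          ((l j : ℂ) • (mulSgn q s • mkL gl0 (xorE q s) (l - epsZ j) .d0
            - mkL q s (l - epsZ j) .d0))
      else
        (-(-1 : ℂ) ^ (gdeg s * gdeg q)) •
          ((l j : ℂ) • (mulSgn q s • mkL gl0 (xorE q s) (l + k) .d0))
  | ⟨s, kk, .d0⟩, ⟨q, kk', .pa β⟩ =>
      (-(-1 : ℂ) ^ (gdeg s * (gdeg q + 1)) * derC β s * mulSgn q (derE β s)) •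
        mkL gl0 (xorE q (derE β s)) (zOf kk (.d0 : Dir m n true) + zOf kk' (.pa β : Dir m n true)) .d0
  | ⟨_, _, .d0⟩, ⟨_, _, .d0⟩ => 0

/-- The full Lie superbracket of `L` on basis elements, obtained from the
generator brackets and the `Λ`-module structure via
`[f X, g Y] = f (Xg) Y − (−1)^{(|f|+|X|)(|g|+|Y|)} g (Yf) X + (−1)^{|X||g|} fg [X,Y]`. -/
def lbb {b : Bool} : LBasis m n b → LBasis m n b → LAlg m n b
  | ⟨a, s, kk, D⟩, ⟨a', q, kk', D'⟩ =>
      lmulL (lmul (lm a) (genOnL (s, kk, D) a')) (Finsupp.single (gl0, q, kk', D') 1)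
        - ((-1 : ℂ) ^ (lpar (⟨a, s, kk, D⟩ : LBasis m n b) *
              lpar (⟨a', q, kk', D'⟩ : LBasis m n b))) •
            lmulL (lmul (lm a') (genOnL (q, kk', D') a)) (Finsupp.single (gl0, s, kk, D) 1)
        + ((-1 : ℂ) ^ (lpar (⟨gl0, s, kk, D⟩ : LBasis m n b) * gdeg a')) •
            lmulL (lmul (lm a) (lm a')) (genBr (s, kk, D) (q, kk', D'))

/-- A module over the jet Lie superalgebra `L`. -/
structure LRep (m n : ℕ) (b : Bool) where
  U : Type
  [addgrp : AddCommGroup U]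
  [mods : Module ℂ U]
  act : LAlg m n b →ₗ[ℂ] U →ₗ[ℂ] U
  super : ∀ x y : LBasis m n b,
    act (lbb x y)
      = act (lsng x) ∘ₗ act (lsng y)
        - ((-1 : ℂ) ^ (lpar x * lpar y)) • (act (lsng y) ∘ₗ act (lsng x))

attribute [instance] LRep.addgrp LRep.mods

/-- A module over the algebra of differential operators `D(Λ, L)`: compatible
actions of `Λ` and of `L`. -/
structure DLRep (m n : ℕ) (b : Bool) extends LRep m n b where
  lact : LamAlg n →ₗ[ℂ] U →ₗ[ℂ] U
  lact_one : lact (lm gl0) = LinearMap.id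
  lact_mul : ∀ s q : GExp n, lact (lmul (lm s) (lm q)) = lact (lm s) ∘ₗ lact (lm q)
  compat1 : ∀ (x : LBasis m n b) (f : GExp n),
    act (lsng x) ∘ₗ lact (lm f)
      = lact (lmul (lm x.1) (genOnL (x.2.1, x.2.2.1, x.2.2.2) f))
        + ((-1 : ℂ) ^ (lpar x * gdeg f)) • (lact (lm f) ∘ₗ act (lsng x))
  compat2 : ∀ (f : GExp n) (x : LBasis m n b),
    lact (lm f) ∘ₗ act (lsng x) = act (lmulL (lm f) (lsng x))

/-- Simplicity of an `L`-module. -/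
def LRep.IsSimple {b : Bool} (σ : LRep m n b) : Prop :=
  (∃ u : σ.U, u ≠ 0) ∧
    ∀ N : Submodule ℂ σ.U,
      (∀ x : LBasis m n b, ∀ u ∈ N, σ.act (lsng x) u ∈ N) → N = ⊥ ∨ N = ⊤

/-- Simplicity of a `D(Λ, L)`-module. -/
def DLRep.IsSimple {b : Bool} (σ : DLRep m n b) : Prop :=
  (∃ u : σ.U, u ≠ 0) ∧
    ∀ N : Submodule ℂ σ.U,
      (∀ x : LBasis m n b, ∀ u ∈ N, σ.act (lsng x) u ∈ N) →
      (∀ f : GExp n, ∀ u ∈ N, σ.lact (lm f) u ∈ N) → N = ⊥ ∨ N = ⊤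

/-! ### The representations of `L` on the weight spaces of the adjoint module,
and the ideal `J`. -/

/-- Basis of the weight space `U = Σ_i t^r Λ d_i ⊕ Σ_α t^r Λ ∂_α` of the adjoint
`AV`-module `W(m,n)`. -/
abbrev UExB (m n : ℕ) := GExp n × Dir m n false

abbrev UEx (m n : ℕ) := UExB m n →₀ ℂ

/-- The action of a generator of `L` on the basis of `U` (from the adjoint
module example, with `f d_0` acting as multiplication by `λ_0 f`). -/
def exGen (r : LExp m) (l0 : ℂ) {b : Bool} (s : GExp n) (kk : Fin m → ℕ)
    (D : Dir m n b) (u : UExB m n) : UEx m n :=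
  match D, u with
  | .di i, (g, .di j) =>
      if kk = 0 then ((r i : ℂ) * mulSgn s g) • Finsupp.single (xorE s g, .di j) 1
      else if kk = natE j then (-(mulSgn s g)) • Finsupp.single (xorE s g, .di i) 1
      else 0
  | .di i, (g, .pa α) =>
      if kk = 0 then
        ((r i : ℂ) * mulSgn s g) • Finsupp.single (xorE s g, .pa α) 1
          - ((-1 : ℂ) ^ (gdeg s + gdeg g) * derC α s * mulSgn (derE α s) g) •
              Finsupp.single (xorE (derE α s) g, .di i) 1
      else 0
  | .pa α, (g, .di j) =>
      if kk = 0 then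
        (derC α g * mulSgn s (derE α g)) • Finsupp.single (xorE s (derE α g), .di j) 1
      else if kk = natE j then
        (-(-1 : ℂ) ^ gdeg g * mulSgn s g) • Finsupp.single (xorE s g, .pa α) 1
      else 0
  | .pa α, (g, .pa β) =>
      if kk = 0 then
        (derC α g * mulSgn s (derE α g)) • Finsupp.single (xorE s (derE α g), .pa β) 1
          + ((-1 : ℂ) ^ gdeg s * derC β s * mulSgn (derE β s) g) •
              Finsupp.single (xorE (derE β s) g, .pa α) 1
      else 0
  | .d0, (g, E) =>
      if kk = 0 then (l0 * mulSgn s g) • Finsupp.single (xorE s g, E) 1 else 0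

/-- The action of a basis element of `L` on the basis of `U`. -/
def exActVal (r : LExp m) (l0 : ℂ) {b : Bool} (x : LBasis m n b) (u : UExB m n) :
    UEx m n :=
  (exGen r l0 x.2.1 x.2.2.1 x.2.2.2 u).sum fun ge c =>
    (c * mulSgn x.1 ge.1) • Finsupp.single (xorE x.1 ge.1, ge.2) 1

def exActB (r : LExp m) (l0 : ℂ) {b : Bool} (x : LBasis m n b) :
    UEx m n →ₗ[ℂ] UEx m n :=
  Finsupp.lsum ℂ fun u => LinearMap.toSpanSingleton ℂ (UEx m n) (exActVal r l0 x u)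

/-- The representation of `L` on the weight space `U` of the adjoint module. -/
def exActL (r : LExp m) (l0 : ℂ) {b : Bool} :
    LAlg m n b →ₗ[ℂ] UEx m n →ₗ[ℂ] UEx m n :=
  Finsupp.lsum ℂ fun x =>
    LinearMap.toSpanSingleton ℂ (UEx m n →ₗ[ℂ] UEx m n) (exActB r l0 x)

/-- The ideal `J = ∩_{r, λ_0} J_{r,λ_0}` of `L`, the intersection of the kernels
of the representations on the weight spaces of the adjoint modules. -/
def Jsub (m n : ℕ) (b : Bool) : Submodule ℂ (LAlg m n b) :=
  ⨅ (r : LExp m) (l0 : ℂ), LinearMap.ker (exActL r l0)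

/-! ### Generators of `L/J` -/

/-- Index type for the `Λ`-basis of `L/J`:
`d_i(1,−ε_i)`, `d_i(ξ_β,−ε_i)`, `d_i(1,ε_j−ε_i)`, `∂_α(1,0)`, `∂_α(ξ_β,0)`,
`∂_α(1,ε_j)` and `d_0(1,0)`. -/
abbrev GenIdx (m n : ℕ) :=
  Fin m ⊕ (Fin m × Fin n) ⊕ (Fin m × Fin m) ⊕ Fin n ⊕ (Fin n × Fin n) ⊕
    (Fin n × Fin m) ⊕ Unit

/-- The generators of `L/J` as elements of `L` (with `b = true`). -/
def gens (m n : ℕ) : GenIdx m n → LAlg m n true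
  | .inl i => lsng (gl0, gl0, 0, .di i)
  | .inr (.inl (i, β)) => lsng (gl0, gOne β, 0, .di i)
  | .inr (.inr (.inl (i, j))) => lsng (gl0, gl0, natE j, .di i)
  | .inr (.inr (.inr (.inl α))) => lsng (gl0, gl0, 0, .pa α)
  | .inr (.inr (.inr (.inr (.inl (α, β))))) => lsng (gl0, gOne β, 0, .pa α)
  | .inr (.inr (.inr (.inr (.inr (.inl (α, j)))))) => lsng (gl0, gl0, natE j, .pa α)
  | .inr (.inr (.inr (.inr (.inr (.inr _))))) => lsng (gl0, gl0, 0, .d0)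

end

end WSuper

namespace WSuper

noncomputable section

variable {m n : ℕ}

/-- Multiplication by a Grassmann monomial on the left factor of `Λ ⊗ V`. -/
def lmulTV {V : Type} [AddCommGroup V] [Module ℂ V] (g : GExp n)
    (u : GExp n →₀ V) : GExp n →₀ V :=
  u.sum fun c v => mulSgn g c • Finsupp.single (xorE g c) v

/-- The explicit action of `(A#V)_0` on `Λ ⊗ V`:
`D_j(f,s) = λ_j f ⊗ Id + Σ_i s_i f ⊗ ρ(e_{ij}) + Σ_α (f)∂*_α ⊗ ρ(e_{αj})`,
`Δ_β(f,s) = f ∂/∂ξ_β ⊗ Id + Σ_i s_i f ⊗ ρ(e_{iβ}) + Σ_α (f)∂*_α ⊗ ρ(e_{αβ})`,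
`D_0(f,s) = λ_0 f ⊗ Id`, with the usual Koszul signs when applying `a ⊗ ρ(e)`
with `e` odd to `g ⊗ v`. -/
def glTensorOp (σ : GlRep m n) (lam : Fin m → ℂ) (lam0 : ℂ) :
    Dir m n true → GExp n → LExp m → (GExp n →₀ σ.V) → (GExp n →₀ σ.V)
  | .di j, f, s => fun u => u.sum fun c v =>
      ((lam j * mulSgn f c) • Finsupp.single (xorE f c) v)
      + (∑ i : Fin m, ((s i : ℂ) * mulSgn f c) •
          Finsupp.single (xorE f c) (σ.ρ (.inl i) (.inl j) v))
      + (∑ α : Fin n,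
          ((-1 : ℂ) ^ gdeg c * ((-1 : ℂ) ^ (gdeg f + 1) * derC α f) *
              mulSgn (derE α f) c) •
            Finsupp.single (xorE (derE α f) c) (σ.ρ (.inr α) (.inl j) v))
  | .pa β, f, s => fun u => u.sum fun c v =>
      ((derC β c * mulSgn f (derE β c)) • Finsupp.single (xorE f (derE β c)) v)
      + (∑ i : Fin m, ((-1 : ℂ) ^ gdeg c * (s i : ℂ) * mulSgn f c) •
          Finsupp.single (xorE f c) (σ.ρ (.inl i) (.inr β) v))
      + (∑ α : Fin n,
          (((-1 : ℂ) ^ (gdeg f + 1) * derC α f) * mulSgn (derE α f) c) •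
            Finsupp.single (xorE (derE α f) c) (σ.ρ (.inr α) (.inr β) v))
  | .d0, f, _ => fun u => u.sum fun c v =>
      (lam0 * mulSgn f c) • Finsupp.single (xorE f c) v

end

section Grassmann

variable {n : ℕ}

@[simp] lemma gl0_apply (a : Fin n) : (gl0 : GExp n) a = false := rfl

@[simp] lemma gOne_apply (β a : Fin n) : gOne β a = decide (a = β) := rfl

@[simp] lemma mulSgn_gl0_left (q : GExp n) : mulSgn gl0 q = 1 := by
  simp [mulSgn, invCount]

@[simp] lemma mulSgn_gl0_right (q : GExp n) : mulSgn q gl0 = 1 := by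
  simp [mulSgn, invCount]

@[simp] lemma xorE_gl0_left (q : GExp n) : xorE gl0 q = q := by
  funext a; simp [xorE]

@[simp] lemma xorE_gl0_right (q : GExp n) : xorE q gl0 = q := by
  funext a; simp [xorE]

lemma xorE_comm (s q : GExp n) : xorE s q = xorE q s := by
  funext a; simp [xorE, Bool.xor_comm]

lemma xorE_eq_gl0_iff (s q : GExp n) : xorE s q = gl0 ↔ s = q := by
  simp [funext_iff, xorE]

lemma exists_eq_true_of_ne_gl0 {s : GExp n} (hs : s ≠ gl0) : ∃ a, s a = true := by
  by_contra! h
  exact hs (funext fun a => by simpa using h a)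

lemma mulSgn_self {s : GExp n} (hs : s ≠ gl0) : mulSgn s s = 0 := by
  obtain ⟨a, ha⟩ := exists_eq_true_of_ne_gl0 hs
  exact if_pos ⟨a, ha, ha⟩

@[simp] lemma gdeg_gl0 : gdeg (gl0 : GExp n) = 0 := by simp [gdeg]

@[simp] lemma gdeg_gOne (β : Fin n) : gdeg (gOne β) = 1 := by
  simp [gdeg, Finset.filter_eq']

lemma gdeg_eq_zero_iff (s : GExp n) : gdeg s = 0 ↔ s = gl0 := by
  simp [gdeg, Finset.filter_eq_empty_iff, funext_iff]

lemma gOne_ne_gl0 (β : Fin n) : gOne β ≠ gl0 := fun h => by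
  simpa using congrFun h β

@[simp] lemma derC_gl0 (a : Fin n) : derC a (gl0 : GExp n) = 0 := by simp [derC]

lemma derC_of_false {a : Fin n} {s : GExp n} (h : s a = false) : derC a s = 0 := by
  simp [derC, h]

lemma derC_ne_zero {a : Fin n} {s : GExp n} (h : s a = true) : derC a s ≠ 0 := by
  simp [derC, h]

@[simp] lemma derC_gOne (a b : Fin n) : derC a (gOne b) = if a = b then 1 else 0 := by
  unfold derC
  split_ifs with h1 h2 h2
  · subst h2
    rw [Finset.filter_false_of_mem]
    · simp
    · rintro x - ⟨h, h'⟩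
      simp only [gOne_apply, decide_eq_true_eq] at h
      exact absurd h' (by simp [h])
  · simp_all
  · simp_all
  · rfl

@[simp] lemma derE_gOne_self (a : Fin n) : derE a (gOne a) = gl0 := by
  funext x; by_cases h : x = a <;> simp [derE, h]

@[simp] lemma derE_apply_self (a : Fin n) (s : GExp n) : derE a s a = false := by
  simp [derE]

lemma derE_apply_of_ne {a x : Fin n} (h : x ≠ a) (s : GExp n) : derE a s x = s x := by
  simp [derE, h]

lemma derE_comm (a b : Fin n) (s : GExp n) : derE a (derE b s) = derE b (derE a s) := by
  funext x; by_cases h : x = a <;> by_cases h' : x = b <;>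
    simp [derE, Function.update_apply, h, h']

lemma gdeg_derE {a : Fin n} {s : GExp n} (h : s a = true) : gdeg (derE a s) + 1 = gdeg s := by
  have : (Finset.univ.filter fun x => derE a s x = true)
      = (Finset.univ.filter fun x => s x = true).erase a := by
    ext x; by_cases hx : x = a <;> simp [derE, Function.update_apply, hx]
  rw [gdeg, this]
  exact Finset.card_erase_add_one (by simpa using h)

lemma xorE_gOne_derE {a : Fin n} {s : GExp n} (h : s a = true) :
    xorE (gOne a) (derE a s) = s := by
  funext x; by_cases hx : x = a
  · subst hx; simp [xorE, h]
  · simp [xorE, derE_apply_of_ne hx, hx]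

lemma mulSgn_comm (s q : GExp n) :
    mulSgn s q = (-1 : ℂ) ^ (gdeg s * gdeg q) * mulSgn q s := by
  unfold mulSgn
  by_cases h : ∃ a, s a = true ∧ q a = true
  · have h' : ∃ a, q a = true ∧ s a = true := by simpa only [and_comm] using h
    simp [h, h']
  · have h' : ¬ ∃ a, q a = true ∧ s a = true := by simpa only [and_comm] using h
    rw [if_neg h, if_neg h']
    have key : invCount s q + invCount q s = gdeg s * gdeg q := by
      have e1 : invCount q s = ((Finset.univ ×ˢ Finset.univ).filter
          fun p : Fin n × Fin n => s p.1 = true ∧ q p.2 = true ∧ p.1 < p.2).card := by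
        unfold invCount
        refine Finset.card_bij (fun p _ => p.swap) ?_ ?_ ?_
        · rintro ⟨a, b⟩ hp
          simp only [Finset.mem_filter, Finset.mem_product, Finset.mem_univ, true_and,
            Prod.fst_swap, Prod.snd_swap] at hp ⊢
          tauto
        · rintro p - p' - hpp
          exact Prod.swap_injective hpp
        · rintro ⟨a, b⟩ hp
          refine ⟨(b, a), ?_, rfl⟩
          simp only [Finset.mem_filter, Finset.mem_product, Finset.mem_univ, true_and] at hp ⊢
          tauto
      rw [e1]
      unfold invCount gdeg
      rw [← Finset.card_product, ← Finset.card_union_of_disjoint]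
      · congr 1
        ext ⟨a, b⟩
        simp only [Finset.mem_union, Finset.mem_filter, Finset.mem_product, Finset.mem_univ,
          true_and]
        constructor
        · tauto
        · rintro ⟨ha, hb⟩
          rcases lt_trichotomy a b with hab | hab | hab
          · tauto
          · subst hab
            exact absurd ⟨a, ha, hb⟩ h
          · tauto
      · rw [Finset.disjoint_filter]
        rintro ⟨a, b⟩ - ⟨-, -, h1⟩ ⟨-, -, h2⟩
        exact absurd h1 (not_lt.mpr h2.le)
    rw [← key, pow_add, mul_assoc, ← mul_pow]
    simp

lemma derC_mul_mulSgn_gOne (a : Fin n) (s : GExp n) :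
    derC a s * mulSgn (gOne a) (derE a s) = if s a = true then 1 else 0 := by
  by_cases h : s a = true
  · have h1 : ¬ ∃ x, gOne a x = true ∧ derE a s x = true := by
      rintro ⟨x, hx, hx'⟩
      simp only [gOne_apply, decide_eq_true_eq] at hx
      subst hx
      simp at hx'
    rw [mulSgn, if_neg h1, derC, if_pos h, if_pos h]
    have : invCount (gOne a) (derE a s)
        = (Finset.univ.filter fun x => s x = true ∧ x < a).card := by
      unfold invCount
      refine Finset.card_bij (fun p _ => p.2) ?_ ?_ ?_
      · rintro ⟨x, y⟩ hp
        simp only [Finset.mem_filter, Finset.mem_product, Finset.mem_univ, true_and,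
          gOne_apply, decide_eq_true_eq] at hp ⊢
        obtain ⟨rfl, hy, hlt⟩ := hp
        exact ⟨by rwa [derE_apply_of_ne hlt.ne] at hy, hlt⟩
      · rintro ⟨x, y⟩ hp ⟨x', y'⟩ hp' hpp
        simp only [Finset.mem_filter, Finset.mem_product, Finset.mem_univ, true_and,
          gOne_apply, decide_eq_true_eq] at hp hp' hpp
        simp [hp.1, hp'.1, hpp]
      · intro y hy
        simp only [Finset.mem_filter, Finset.mem_univ, true_and] at hy
        refine ⟨(a, y), ?_, rfl⟩
        simp [derE_apply_of_ne hy.2.ne, hy]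
    rw [this, ← mul_pow]
    simp
  · simp [derC, h]

lemma derC_mul_derC (a b : Fin n) (s : GExp n) :
    derC a s * derC b (derE a s) = -(derC b s * derC a (derE b s)) := by
  by_cases hab : a = b
  · subst hab
    simp [derC_of_false]
  by_cases ha : s a = true
  swap
  · rw [Bool.not_eq_true] at ha
    rw [derC_of_false ha, derC_of_false (a := a) (s := derE b s)]
    · simp
    · rw [derE_apply_of_ne hab, ha]
  by_cases hb : s b = true
  swap
  · rw [Bool.not_eq_true] at hb
    rw [derC_of_false hb, derC_of_false (a := b) (s := derE a s)]
    · simp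
    · rw [derE_apply_of_ne (Ne.symm hab), hb]
  wlog hlt : a < b generalizing a b
  · rw [this b a (Ne.symm hab) hb ha (lt_of_le_of_ne (not_lt.mp hlt) (Ne.symm hab)), neg_neg]
  have h1 : (Finset.univ.filter fun x => derE b s x = true ∧ x < a)
      = Finset.univ.filter fun x => s x = true ∧ x < a := by
    ext x
    simp only [Finset.mem_filter, Finset.mem_univ, true_and]
    refine and_congr_left fun hx => ?_
    rw [derE_apply_of_ne (hx.trans hlt).ne]
  have h2 : (Finset.univ.filter fun x => s x = true ∧ x < b).card
      = (Finset.univ.filter fun x => derE a s x = true ∧ x < b).card + 1 := by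
    rw [← Finset.card_erase_add_one (a := a)]
    · congr 2
      ext x
      by_cases hx : x = a
      · simp [hx]
      · simp [hx, derE_apply_of_ne hx]
    · simp [ha, hlt]
  rw [derC, derC, derC, derC, if_pos ha, if_pos hb, derE_apply_of_ne hab,
    derE_apply_of_ne (Ne.symm hab), if_pos ha, if_pos hb, h1, h2]
  ring

lemma neg_one_pow_mod_two_mul (a b : ℕ) : (-1 : ℂ) ^ (a % 2 * b) = (-1) ^ (a * b) := by
  rw [pow_mul, pow_mul, ← neg_one_pow_eq_pow_mod_two]

end Grassmann

noncomputable section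
section JetAlgebra

variable {m n : ℕ} {b : Bool}

@[simp] lemma lmul_zero_right (f : LamAlg n) : lmul f 0 = 0 := by
  simp [lmul, Finsupp.sum]

lemma lmul_lm_lm (s q : GExp n) : lmul (lm s) (lm q) = mulSgn s q • lm (xorE s q) := by
  simp [lmul, lm, -Finsupp.single_mul]

lemma lmul_lm_gl0 (f : LamAlg n) : lmul (lm gl0) f = f := by
  simp [lmul, lm, -Finsupp.single_mul]

@[simp] lemma lmulL_zero_left (z : LAlg m n b) : lmulL 0 z = 0 := by
  simp [lmulL]

lemma lmulL_lm_gl0 (z : LAlg m n b) : lmulL (lm gl0) z = z := by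
  simp [lmulL, lm, -Finsupp.single_mul]

lemma lmulL_lm_lsng (a s : GExp n) (kk : Fin m → ℕ) (D : Dir m n b) :
    lmulL (lm a) (lsng (gl0, s, kk, D)) = lsng (a, s, kk, D) := by
  simp [lmulL, lm, lsng, -Finsupp.single_mul]

@[simp] lemma genOnL_gl0 (g : GExp n × (Fin m → ℕ) × Dir m n b) :
    genOnL g gl0 = 0 := by
  obtain ⟨s, kk, D⟩ := g
  cases D <;> simp [genOnL]

lemma lbb_gl0 (g g' : GExp n × (Fin m → ℕ) × Dir m n b) :
    lbb (gl0, g) (gl0, g') = genBr g g' := by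
  obtain ⟨s, kk, D⟩ := g
  obtain ⟨s', kk', D'⟩ := g'
  simp [lbb, lmul_lm_gl0, lmulL_lm_gl0]

lemma mkL_eq_zero_or (a s : GExp n) (k : Fin m → ℤ) (D : Dir m n b) :
    mkL a s k D = 0 ∨ ∃ kk, mkL a s k D = lsng (a, s, kk, D) := by
  unfold mkL
  split_ifs
  · exact Or.inr ⟨_, rfl⟩
  · exact Or.inl rfl

lemma mkL_zOf (a s : GExp n) (kk : Fin m → ℕ) (D : Dir m n b) :
    mkL a s (zOf kk D) D = lsng (a, s, kk, D) := by
  simp [mkL, zOf, lsng]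

/-- The exponents and directions of the generators `D(ξ^s, k)` of `L`. -/
abbrev JetGen (m n : ℕ) := GExp n × (Fin m → ℕ) × Dir m n true

/-- The generators of `L` other than the `∂_β(1, 0)`. -/
def JetGen.NotPartial (g : JetGen m n) : Prop := ∀ β, g ≠ (gl0, 0, .pa β)

end JetAlgebra

namespace DLRep

variable {m n : ℕ} (σ : DLRep m n true)

/-- The action of a generator `D(ξ^s, k)` of `L`. -/
def gen (g : JetGen m n) : Module.End ℂ σ.U := σ.act (lsng (gl0, g))

/-- Multiplication by a Grassmann monomial. -/
def xi (c : GExp n) : Module.End ℂ σ.U := σ.lact (lm c)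

/-- The action of `∂_β(1, 0)`. -/
def partialOp (β : Fin n) : Module.End ℂ σ.U := σ.gen (gl0, 0, .pa β)

@[simp] lemma xi_gl0 (u : σ.U) : σ.xi gl0 u = u := by
  simp [xi, σ.lact_one]

lemma xi_xi (s q : GExp n) (u : σ.U) :
    σ.xi s (σ.xi q u) = mulSgn s q • σ.xi (xorE s q) u := by
  have h := LinearMap.congr_fun (σ.lact_mul s q) u
  rw [lmul_lm_lm, map_smul] at h
  exact h.symm

lemma xi_xi_comm (s q : GExp n) (u : σ.U) :
    σ.xi s (σ.xi q u) = (-1 : ℂ) ^ (gdeg s * gdeg q) • σ.xi q (σ.xi s u) := by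
  rw [xi_xi, xi_xi, mulSgn_comm, smul_smul, xorE_comm]

lemma act_lsng (a : GExp n) (g : JetGen m n) (u : σ.U) :
    σ.act (lsng (a, g)) u = σ.xi a (σ.gen g u) := by
  have h := LinearMap.congr_fun (σ.compat2 a (gl0, g)) u
  rw [lmulL_lm_lsng] at h
  exact h.symm

lemma gen_xi (g : JetGen m n) (c : GExp n) (u : σ.U) :
    σ.gen g (σ.xi c u)
      = σ.lact (genOnL g c) u
        + (-1 : ℂ) ^ (lpar ((gl0, g) : LBasis m n true) * gdeg c) • σ.xi c (σ.gen g u) := by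
  have h := LinearMap.congr_fun (σ.compat1 (gl0, g) c) u
  rw [lmul_lm_gl0] at h
  exact h

lemma act_genBr (g g' : JetGen m n) (u : σ.U) :
    σ.act (genBr g g') u
      = σ.gen g (σ.gen g' u)
        - (-1 : ℂ) ^ (lpar ((gl0, g) : LBasis m n true) *
            lpar ((gl0, g') : LBasis m n true)) • σ.gen g' (σ.gen g u) := by
  have h := LinearMap.congr_fun (σ.super (gl0, g) (gl0, g')) u
  rw [lbb_gl0] at h
  exact h

lemma partialOp_xi (β : Fin n) (c : GExp n) (u : σ.U) :
    σ.partialOp β (σ.xi c u)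
      = derC β c • σ.xi (derE β c) u + (-1 : ℂ) ^ gdeg c • σ.xi c (σ.partialOp β u) := by
  rw [partialOp, gen_xi]
  simp [genOnL, lpar, xi]

lemma partialOp_partialOp (β γ : Fin n) (u : σ.U) :
    σ.partialOp β (σ.partialOp γ u) = -σ.partialOp γ (σ.partialOp β u) := by
  have h := σ.act_genBr (gl0, 0, .pa β) (gl0, 0, .pa γ) u
  simp only [genBr, derC_gl0, lpar] at h
  simp only [gdeg_gl0, zero_mul, mul_zero, zero_smul, sub_zero, map_zero,
    LinearMap.zero_apply] at h
  rw [partialOp, partialOp, ← sub_eq_zero, h]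
  simp

lemma partialOp_self (β : Fin n) (u : σ.U) : σ.partialOp β (σ.partialOp β u) = 0 := by
  have h := σ.partialOp_partialOp β β u
  rw [eq_neg_iff_add_eq_zero, ← two_smul ℂ] at h
  exact (smul_eq_zero.mp h).resolve_left two_ne_zero

/-- The vacuum space, on which all `∂_β(1, 0)` vanish. -/
def vac : Submodule ℂ σ.U := ⨅ β, LinearMap.ker (σ.partialOp β)

variable {σ} in
lemma mem_vac {u : σ.U} : u ∈ σ.vac ↔ ∀ β, σ.partialOp β u = 0 := by
  simp [vac]

lemma partialOp_vac (v : σ.vac) (β : Fin n) : σ.partialOp β v = 0 := mem_vac.mp v.2 β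

/-- The Taylor expansion map `Λ ⊗ V → U`, `ξ^c ⊗ v ↦ ξ^c v`. -/
def taylor : (GExp n →₀ σ.vac) →ₗ[ℂ] σ.U :=
  Finsupp.lsum ℂ fun c => σ.xi c ∘ₗ σ.vac.subtype

@[simp] lemma taylor_single (c : GExp n) (v : σ.vac) :
    σ.taylor (Finsupp.single c v) = σ.xi c v := by
  simp [taylor]

lemma exists_xi_mem_span (S : Finset (Fin n)) (u : σ.U) :
    u ∈ Submodule.span ℂ
      {x | ∃ c w, (∀ β ∈ S, σ.partialOp β w = 0) ∧ x = σ.xi c w} := by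
  induction S using Finset.induction_on with
  | empty => exact Submodule.subset_span ⟨gl0, u, by simp, by simp⟩
  | insert β S _ ih =>
    refine Submodule.span_le.mpr ?_ ih
    rintro _ ⟨c, w, hw, rfl⟩
    set T := Submodule.span ℂ
      {x | ∃ c w, (∀ γ ∈ insert β S, σ.partialOp γ w = 0) ∧ x = σ.xi c w}
    have h1 : σ.xi c (w - σ.xi (gOne β) (σ.partialOp β w)) ∈ T := by
      refine Submodule.subset_span ⟨c, _, ?_, rfl⟩
      intro γ hγ
      rw [map_sub, partialOp_xi, partialOp_partialOp]
      rcases Finset.mem_insert.mp hγ with rfl | hγ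
      · simp [partialOp_self]
      · by_cases hγβ : γ = β
        · subst hγβ
          simp [partialOp_self]
        · simp [hw γ hγ, hγβ]
    have h2 : σ.xi c (σ.xi (gOne β) (σ.partialOp β w)) ∈ T := by
      rw [xi_xi]
      refine T.smul_mem _ (Submodule.subset_span ⟨_, _, ?_, rfl⟩)
      intro γ hγ
      rcases Finset.mem_insert.mp hγ with rfl | hγ
      · exact σ.partialOp_self _ _
      · rw [partialOp_partialOp, hw γ hγ, map_zero, neg_zero]
    have h3 := T.add_mem h1 h2
    rwa [map_sub, sub_add_cancel] at h3

lemma taylor_surjective : Function.Surjective σ.taylor := by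
  rw [← LinearMap.range_eq_top, eq_top_iff]
  rintro u -
  refine Submodule.span_le.mpr ?_ (σ.exists_xi_mem_span Finset.univ u)
  rintro _ ⟨c, w, hw, rfl⟩
  exact ⟨Finsupp.single c ⟨w, mem_vac.mpr fun β => hw β (Finset.mem_univ β)⟩, by simp⟩

/-- The derivation `∂_β ⊗ 1` of `Λ ⊗ V`. -/
def tensorDer (β : Fin n) : (GExp n →₀ σ.vac) →ₗ[ℂ] (GExp n →₀ σ.vac) :=
  Finsupp.lsum ℂ fun c => derC β c • Finsupp.lsingle (derE β c)

lemma tensorDer_single (β : Fin n) (c : GExp n) (v : σ.vac) :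
    σ.tensorDer β (Finsupp.single c v) = derC β c • Finsupp.single (derE β c) v := by
  simp [tensorDer]

lemma taylor_tensorDer (β : Fin n) (w : GExp n →₀ σ.vac) :
    σ.taylor (σ.tensorDer β w) = σ.partialOp β (σ.taylor w) := by
  induction w using Finsupp.induction_linear with
  | zero => simp
  | add f g hf hg => simp only [map_add, hf, hg]
  | single c v =>
    rw [tensorDer_single, map_smul, taylor_single, taylor_single, partialOp_xi,
      partialOp_vac]
    simp

lemma tensorDer_apply_derE (β : Fin n) (w : GExp n →₀ σ.vac) {c : GExp n}
    (hc : c β = true) : σ.tensorDer β w (derE β c) = derC β c • w c := by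
  induction w using Finsupp.induction_linear with
  | zero => simp
  | add f g hf hg => simp only [map_add, Finsupp.add_apply, hf, hg, smul_add]
  | single d v =>
    rw [tensorDer_single, Finsupp.smul_apply]
    by_cases hdc : d = c
    · subst hdc; simp
    · rw [Finsupp.single_eq_of_ne (Ne.symm hdc), smul_zero]
      by_cases hd : d β = true
      · rw [Finsupp.single_eq_of_ne, smul_zero]
        intro h
        apply hdc
        rw [← xorE_gOne_derE hd, ← xorE_gOne_derE hc, h]
      · rw [derC_of_false (by simpa using hd), zero_smul]

lemma tensorDer_apply_of_true (β : Fin n) (w : GExp n →₀ σ.vac) {c : GExp n}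
    (hc : c β = true) : σ.tensorDer β w c = 0 := by
  induction w using Finsupp.induction_linear with
  | zero => simp
  | add f g hf hg => simp only [map_add, Finsupp.add_apply, hf, hg, add_zero]
  | single d v =>
    rw [tensorDer_single, Finsupp.smul_apply, Finsupp.single_eq_of_ne, smul_zero]
    rintro rfl
    simp at hc

lemma eq_zero_of_taylor_eq_zero (d : ℕ) (w : GExp n →₀ σ.vac)
    (hw : ∀ c, d ≤ gdeg c → w c = 0) (h : σ.taylor w = 0) : w = 0 := by
  induction d generalizing w with
  | zero => ext c; simp [hw c]
  | succ d ih =>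
    have hD : ∀ β, σ.tensorDer β w = 0 := by
      intro β
      refine ih _ ?_ (by rw [taylor_tensorDer, h, map_zero])
      intro c hc
      by_cases hcβ : c β = true
      · exact σ.tensorDer_apply_of_true β w hcβ
      · have h1 : Function.update c β true β = true := by simp
        have h2 : derE β (Function.update c β true) = c := by
          funext x; by_cases hx : x = β
          · subst hx; simpa using hcβ
          · simp [derE, hx]
        have h3 := gdeg_derE h1
        rw [h2] at h3
        rw [← h2, tensorDer_apply_derE _ _ _ h1, hw _ (by omega), smul_zero]
    have h0 : ∀ c, c ≠ gl0 → w c = 0 := by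
      intro c hc
      obtain ⟨β, hβ⟩ := exists_eq_true_of_ne_gl0 hc
      have := σ.tensorDer_apply_derE β w hβ
      rw [hD β] at this
      exact (smul_eq_zero.mp this.symm).resolve_left (derC_ne_zero hβ)
    have hw0 : w = Finsupp.single gl0 (w gl0) := by
      ext c
      by_cases hc : c = gl0
      · subst hc; simp
      · rw [h0 c hc, Finsupp.single_eq_of_ne hc]
    rw [hw0, taylor_single, xi_gl0] at h
    have h0 : w gl0 = 0 := Subtype.ext h
    rw [hw0, h0, Finsupp.single_zero]

lemma taylor_injective : Function.Injective σ.taylor := by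
  rw [← LinearMap.ker_eq_bot, LinearMap.ker_eq_bot']
  intro w hw
  refine σ.eq_zero_of_taylor_eq_zero (n + 1) w (fun c hc => ?_) hw
  have : gdeg c ≤ n := by
    simpa [gdeg] using Finset.card_filter_le Finset.univ fun a => c a = true
  omega

/-- The isomorphism `U ≅ Λ ⊗ V`. -/
def taylorEquiv : σ.U ≃ₗ[ℂ] (GExp n →₀ σ.vac) :=
  (LinearEquiv.ofBijective σ.taylor ⟨σ.taylor_injective, σ.taylor_surjective⟩).symm

@[simp] lemma taylor_taylorEquiv (u : σ.U) : σ.taylor (σ.taylorEquiv u) = u :=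
  (LinearEquiv.ofBijective σ.taylor _).apply_symm_apply u

@[simp] lemma taylorEquiv_taylor (w : GExp n →₀ σ.vac) : σ.taylorEquiv (σ.taylor w) = w :=
  (LinearEquiv.ofBijective σ.taylor _).symm_apply_apply w

lemma taylorEquiv_xi (g : GExp n) (u : σ.U) :
    σ.taylorEquiv (σ.xi g u) = lmulTV g (σ.taylorEquiv u) := by
  apply σ.taylor_injective
  rw [taylor_taylorEquiv, lmulTV, map_finsuppSum]
  conv_lhs => rw [← σ.taylor_taylorEquiv u, ← Finsupp.sum_single (σ.taylorEquiv u)]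
  rw [map_finsuppSum, map_finsuppSum]
  refine Finsupp.sum_congr fun c _ => ?_
  rw [map_smul, taylor_single, taylor_single, xi_xi]

/-- The projection of `U ≅ Λ ⊗ V` onto its component of Grassmann exponent `0`. -/
def proj : σ.U →ₗ[ℂ] σ.vac := Finsupp.lapply gl0 ∘ₗ σ.taylorEquiv.toLinearMap

lemma proj_apply (u : σ.U) : σ.proj u = σ.taylorEquiv u gl0 := rfl

lemma proj_xi {c : GExp n} (hc : c ≠ gl0) (u : σ.U) : σ.proj (σ.xi c u) = 0 := by
  rw [proj_apply, taylorEquiv_xi, lmulTV, Finsupp.sum, Finsupp.finsetSum_apply]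
  refine Finset.sum_eq_zero fun d _ => ?_
  rw [Finsupp.smul_apply]
  by_cases h : xorE c d = gl0
  · rw [xorE_eq_gl0_iff] at h
    subst h
    rw [mulSgn_self hc, zero_smul]
  · rw [Finsupp.single_eq_of_ne (Ne.symm h), smul_zero]

@[simp] lemma proj_vac (v : σ.vac) : σ.proj v = v := by
  have : (v : σ.U) = σ.taylor (Finsupp.single gl0 v) := by simp
  rw [this, proj_apply, taylorEquiv_taylor, Finsupp.single_eq_same]

lemma eq_zero_of_proj_of_partialOp {u : σ.U} (h : σ.proj u = 0)
    (h' : ∀ β, σ.partialOp β u = 0) : u = 0 := by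
  have := σ.proj_vac ⟨u, mem_vac.mpr h'⟩
  rw [h] at this
  exact (congrArg Subtype.val this).symm

end DLRep
end

noncomputable section

namespace DLRep

variable {m n : ℕ} (σ : DLRep m n true)

/-- The operator on the vacuum space induced by an element of `L`. -/
def vacAct : LAlg m n true →ₗ[ℂ] Module.End ℂ σ.vac where
  toFun z := σ.proj ∘ₗ σ.act z ∘ₗ σ.vac.subtype
  map_add' x y := by ext v; simp
  map_smul' c x := by ext v; simp

/-- The operator on the vacuum space induced by a generator of `L`. -/
def vacGen (g : JetGen m n) : Module.End ℂ σ.vac := σ.vacAct (lsng (gl0, g))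

lemma vacAct_apply (z : LAlg m n true) (v : σ.vac) : σ.vacAct z v = σ.proj (σ.act z v) := rfl

lemma vacGen_apply (g : JetGen m n) (v : σ.vac) : σ.vacGen g v = σ.proj (σ.gen g v) := rfl

lemma vacGen_partial (β : Fin n) : σ.vacGen (gl0, 0, .pa β) = 0 := by
  ext v
  rw [vacGen_apply, ← partialOp, partialOp_vac, map_zero]
  rfl

lemma vacAct_mkL_of_ne {a : GExp n} (ha : a ≠ gl0) (s : GExp n) (k : Fin m → ℤ)
    (D : Dir m n true) : σ.vacAct (mkL a s k D) = 0 := by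
  ext v
  rcases mkL_eq_zero_or a s k D with h | ⟨kk, h⟩
  · simp [h]
  · rw [h, vacAct_apply, act_lsng, proj_xi _ ha]
    rfl

lemma vacAct_mkL {s : GExp n} {k : Fin m → ℤ} {D : Dir m n true} {kk : Fin m → ℕ}
    (h : k = zOf kk D) : σ.vacAct (mkL gl0 s k D) = σ.vacGen (s, kk, D) := by
  rw [h, mkL_zOf, vacGen]

lemma act_mkL {s : GExp n} {k : Fin m → ℤ} {D : Dir m n true} {kk : Fin m → ℕ}
    (h : k = zOf kk D) : σ.act (mkL gl0 s k D) = σ.gen (s, kk, D) := by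
  rw [h, mkL_zOf, gen]

variable {σ} in
lemma proj_lact_genOnL {g : JetGen m n} (hg : g.NotPartial) (c : GExp n) (u : σ.U) :
    σ.proj (σ.lact (genOnL g c) u) = 0 := by
  obtain ⟨s, kk, D⟩ := g
  cases D with
  | di i => simp [genOnL]
  | d0 => simp [genOnL]
  | pa α =>
    simp only [genOnL]
    split_ifs with h
    · subst h
      have hs : s ≠ gl0 := fun h => hg α (by rw [h])
      have := σ.proj_xi hs (σ.xi (derE α c) u)
      rw [xi_xi, map_smul] at this
      rw [map_smul, LinearMap.smul_apply, map_smul, mul_smul]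
      change _ • _ • σ.proj (σ.xi _ u) = 0
      rw [this, smul_zero]
    · simp

variable {σ} in
lemma proj_gen_proj {g : JetGen m n} (hg : g.NotPartial) (u : σ.U) :
    σ.proj (σ.gen g u) = σ.proj (σ.gen g (σ.proj u)) := by
  rw [← σ.taylor_taylorEquiv u]
  induction σ.taylorEquiv u using Finsupp.induction_linear with
  | zero => simp
  | add f g hf hg => simp only [map_add, hf, hg, Submodule.coe_add]
  | single c v =>
    rw [taylor_single]
    by_cases hc : c = gl0
    · subst hc; simp
    · rw [proj_xi _ hc, gen_xi, map_add, proj_lact_genOnL hg, map_smul, proj_xi _ hc]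
      simp

variable {σ} in
lemma vacAct_genBr {g g' : JetGen m n} (hg : g.NotPartial) (hg' : g'.NotPartial) :
    σ.vacAct (genBr g g')
      = σ.vacGen g * σ.vacGen g'
        - (-1 : ℂ) ^ (lpar ((gl0, g) : LBasis m n true) *
            lpar ((gl0, g') : LBasis m n true)) • (σ.vacGen g' * σ.vacGen g) := by
  ext v
  rw [vacAct_apply, act_genBr, map_sub, map_smul, proj_gen_proj hg, proj_gen_proj hg' (σ.gen g v)]
  rfl

lemma partialOp_gen (β : Fin n) (s : GExp n) (kk : Fin m → ℕ) (D : Dir m n true)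
    (v : σ.vac) :
    σ.partialOp β (σ.gen (s, kk, D) v) = derC β s • σ.gen (derE β s, kk, D) v := by
  have h := σ.act_genBr (gl0, 0, .pa β) (s, kk, D) v
  rw [← partialOp, partialOp_vac, map_zero, smul_zero, sub_zero] at h
  rw [← h]
  have hz : zOf 0 (.pa β : Dir m n true) = 0 := by funext i; simp [zOf, dsh]
  have hsq : (-1 : ℂ) ^ gdeg s * (-1) ^ gdeg s = 1 := by rw [← mul_pow]; simp
  cases D with
  | di i =>
    have h0 : zOf 0 (.pa β : Dir m n true) - epsZ i = zOf 0 (.di i : Dir m n true) := by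
      funext j; simp [zOf, dsh, epsZ]
    simp only [genBr]
    split_ifs with hkk
    · subst hkk
      simp only [hz, gdeg_gl0, zero_add, one_mul, add_zero, Pi.zero_apply, Int.cast_zero, zero_smul, zero_sub,
        mulSgn_gl0_right, xorE_gl0_right, mul_one, smul_neg, smul_smul]
      rw [hz] at h0
      rw [zero_sub] at h0
      rw [map_neg, map_smul, σ.act_mkL h0, neg_mul, ← mul_assoc, hsq, one_mul, neg_smul, neg_neg]
      rfl
    · simp only [hz, gdeg_gl0, zero_add, one_mul, add_zero, Pi.zero_apply, Int.cast_zero, zero_smul, zero_sub,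
        mulSgn_gl0_right, xorE_gl0_right, mul_one, smul_neg, smul_smul]
      rw [map_neg, map_smul, σ.act_mkL rfl, neg_mul, ← mul_assoc, hsq, one_mul, neg_smul, neg_neg]
      rfl
  | pa γ =>
    simp only [genBr, hz, zero_add]
    simp only [mulSgn_gl0_left, xorE_gl0_left, mul_one, derC_gl0, mul_zero, zero_mul,
      zero_smul, sub_zero]
    rw [map_smul, σ.act_mkL rfl]
    rfl
  | d0 =>
    simp only [genBr, hz, zero_add]
    simp only [mulSgn_gl0_left, xorE_gl0_left, mul_one]
    rw [map_smul, σ.act_mkL rfl]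
    rfl

/-! ### The action of `gl(m,n)` on the vacuum space -/

/-- The Grassmann exponent attached to the first index of `e_{xy}`. -/
def glExp : GlIdx m n → GExp n
  | .inl _ => gl0
  | .inr α => gOne α

/-- The polynomial exponent attached to the first index of `e_{xy}`. -/
def glDeg : GlIdx m n → Fin m → ℕ
  | .inl i => natE i
  | .inr _ => 0

/-- The direction attached to the second index of `e_{xy}`. -/
def glDir : GlIdx m n → Dir m n true
  | .inl j => .di j
  | .inr β => .pa β

@[simp] lemma zOf_di (kk : Fin m → ℕ) (i j : Fin m) :
    zOf kk (.di i : Dir m n true) j = kk j - if j = i then 1 else 0 := by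
  simp [zOf, dsh]

@[simp] lemma zOf_pa (kk : Fin m → ℕ) (β : Fin n) (j : Fin m) :
    zOf kk (.pa β : Dir m n true) j = kk j := by
  simp [zOf, dsh]

@[simp] lemma zOf_d0 (kk : Fin m → ℕ) (j : Fin m) :
    zOf kk (.d0 : Dir m n true) j = kk j := by
  simp [zOf, dsh]

/-- The generator of `L` inducing `e_{xy}` on the vacuum space. -/
def glGen (x y : GlIdx m n) : JetGen m n := (glExp x, glDeg x, glDir y)

lemma natE_ne_zero (i : Fin m) : natE i ≠ 0 := fun h => by
  simpa [natE] using congrFun h i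

lemma glGen_notPartial (x y : GlIdx m n) : (glGen x y).NotPartial := by
  intro β h
  rcases x with i | α
  · exact natE_ne_zero i (congrArg (fun g => g.2.1) h)
  · exact gOne_ne_gl0 α (congrArg (fun g => g.1) h)

end DLRep
end

noncomputable section

namespace DLRep

variable {m n : ℕ} (σ : DLRep m n true)

set_option maxHeartbeats 2000000 in
lemma vacGen_glGen_rel (x y z w : GlIdx m n) :
    σ.vacGen (glGen x y) * σ.vacGen (glGen z w)
        - ((-1 : ℂ) ^ ((gpar x + gpar y) * (gpar z + gpar w))) •
            (σ.vacGen (glGen z w) * σ.vacGen (glGen x y))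
      = (if y = z then σ.vacGen (glGen x w) else 0)
        - ((-1 : ℂ) ^ ((gpar x + gpar y) * (gpar z + gpar w))) •
            (if w = x then σ.vacGen (glGen z y) else 0) := by
  have hpar : ∀ x y : GlIdx m n,
      lpar ((gl0, glGen x y) : LBasis m n true) = (gpar x + gpar y) % 2 := by
    rintro (i | α) (j | β) <;> simp [lpar, glGen, glExp, glDir, gpar]
  have hsgn : ∀ a b : ℕ, (-1 : ℂ) ^ ((a % 2) * (b % 2)) = (-1) ^ (a * b) := by
    intro a b
    rw [neg_one_pow_mod_two_mul, mul_comm, neg_one_pow_mod_two_mul, mul_comm]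
  have h := vacAct_genBr (σ := σ) (glGen_notPartial x y) (glGen_notPartial z w)
  rw [hpar, hpar, hsgn] at h
  rw [← h]
  rcases x with i | α <;> rcases y with j | β <;> rcases z with k | γ <;>
    rcases w with l | δ <;>
    simp only [glGen, glExp, glDeg, glDir, genBr, natE_ne_zero, gpar, if_false, if_true,
      and_self, false_and, and_false, derC_gl0, gdeg_gl0, gdeg_gOne, derC_gOne,
      mulSgn_gl0_left, mulSgn_gl0_right, xorE_gl0_left, xorE_gl0_right, map_sub, map_smul,
      map_zero, reduceCtorEq, Sum.inl.injEq, Sum.inr.injEq,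
      σ.vacAct_mkL_of_ne (gOne_ne_gl0 _)]
  · by_cases hjk : (j = k)
    · subst hjk
      have h1 : zOf (natE i) (.di j : Dir m n true) + zOf (natE j) (.di l : Dir m n true)
          = zOf (natE i) (.di l : Dir m n true) := by
        funext x; simp [natE]
      by_cases hli : (l = i)
      · subst hli
        have h2 : zOf (natE l) (.di j : Dir m n true) + zOf (natE j) (.di l : Dir m n true)
            = zOf (natE j) (.di j : Dir m n true) := by
          funext x; simp [natE]
        by_cases hjl : (j = l)
        · subst hjl
          simp [natE]
        · simp [natE, hjl, Ne.symm hjl, σ.vacAct_mkL h1, σ.vacAct_mkL h2]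
      · by_cases hjl : (j = l)
        · subst hjl
          simp [natE, hli, σ.vacAct_mkL h1]
          module
        · simp [natE, hli, hjl, Ne.symm hjl, σ.vacAct_mkL h1]
    · by_cases hli : (l = i)
      · subst hli
        have h2 : zOf (natE l) (.di j : Dir m n true) + zOf (natE k) (.di l : Dir m n true)
            = zOf (natE k) (.di j : Dir m n true) := by
          funext x; simp [natE]
        by_cases hjl : (j = l)
        · subst hjl
          simp [natE, hjk, σ.vacAct_mkL h2]
          module
        · simp [natE, hjk, hjl, Ne.symm hjl, σ.vacAct_mkL h2]
      · by_cases hjl : (j = l)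
        · subst hjl
          simp [natE, hjk, hli]
        · simp [natE, hjk, hli, hjl, Ne.symm hjl]
  · by_cases hjk : (j = k)
    · subst hjk
      rw [σ.vacAct_mkL (s := gl0) (D := .pa δ) (kk := natE i) (by funext x; simp [natE])]
      simp [natE]
    · simp [natE, hjk]
  · by_cases hli : (l = i)
    · subst hli
      rw [σ.vacAct_mkL (s := gOne γ) (D := .di j) (kk := 0) (by funext x; simp [natE, epsZ])]
      by_cases hjl : (j = l)
      · subst hjl
        simp [natE]
        module
      · simp [natE, hjl, Ne.symm hjl]
        module
    · by_cases hjl : (j = l)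
      · subst hjl
        simp [natE, hli]
      · simp [natE, hli, hjl, Ne.symm hjl]
  · simp
  · by_cases hli : (l = i)
    · subst hli
      rw [σ.vacAct_mkL (s := gl0) (D := .pa β) (kk := natE k) (by funext x; simp [natE])]
      simp [natE]
      module
    · simp [natE, hli]
  · simp
  · by_cases hβγ : (β = γ)
    · subst hβγ
      rw [derE_gOne_self]
      rw [σ.vacAct_mkL (s := gl0) (D := .di l) (kk := natE i)
        (by funext x; simp [natE, epsZ])]
      by_cases hli : (l = i)
      · subst hli
        rw [σ.vacAct_mkL (s := gOne β) (D := .pa β) (kk := 0)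
          (by funext x; simp [natE, epsZ])]
        simp [natE]
        module
      · simp [natE, hli]
        module
    · by_cases hli : (l = i)
      · subst hli
        rw [σ.vacAct_mkL (s := gOne γ) (D := .pa β) (kk := 0)
          (by funext x; simp [natE, epsZ])]
        simp [natE, hβγ]
        module
      · simp [natE, hli, hβγ]
  · by_cases hβγ : (β = γ)
    · subst hβγ
      rw [derE_gOne_self]
      rw [σ.vacAct_mkL (s := gl0) (D := .pa δ) (kk := natE i)
        (by funext x; simp [natE])]
      simp
    · simp [hβγ]
  · by_cases hjk : (j = k)
    · subst hjk
      rw [σ.vacAct_mkL (s := gOne α) (D := .di l) (kk := 0)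
        (by funext x; simp [natE, epsZ])]
      by_cases hjl : (j = l)
      · subst hjl
        simp [natE]
      · simp [natE, hjl]
    · by_cases hjl : (j = l)
      · subst hjl
        simp [natE, hjk]
      · simp [natE, hjk, hjl]
  · rw [σ.vacAct_mkL (s := derE δ (gOne α)) (D := .di j) (kk := natE k)
        (by funext x; simp [natE, epsZ])]
    by_cases hjk : (j = k)
    · subst hjk
      rw [σ.vacAct_mkL (s := gOne α) (D := .pa δ) (kk := 0)
        (by funext x; simp [natE, epsZ])]
      by_cases hδα : (δ = α)
      · subst hδα
        simp [natE, derE_gOne_self]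
      · simp [natE, hδα]
    · by_cases hδα : (δ = α)
      · subst hδα
        simp [natE, derE_gOne_self, hjk]
      · simp [natE, hδα, hjk]
  · simp
  · by_cases hδα : (δ = α)
    · subst hδα
      rw [derE_gOne_self]
      rw [σ.vacAct_mkL (s := xorE gl0 (gOne γ)) (D := .di j) (kk := 0)
        (by funext x; simp [epsZ])]
      simp
    · simp [hδα]
  · simp
  · by_cases hδα : (δ = α)
    · subst hδα
      rw [derE_gOne_self]
      rw [σ.vacAct_mkL (s := gl0) (D := .pa β) (kk := natE k)
        (by funext x; simp [natE])]
      simp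
    · simp [hδα]
  · by_cases hβγ : (β = γ)
    · subst hβγ
      rw [derE_gOne_self]
      rw [σ.vacAct_mkL (s := xorE gl0 (gOne α)) (D := .di l) (kk := 0)
        (by funext x; simp [epsZ])]
      simp
    · simp [hβγ]
  · rw [σ.vacAct_mkL (s := xorE (gOne α) (derE β (gOne γ))) (D := .pa δ) (kk := 0)
        (by funext x; simp),
      σ.vacAct_mkL (s := xorE (derE δ (gOne α)) (gOne γ)) (D := .pa β) (kk := 0)
        (by funext x; simp)]
    by_cases hβγ : (β = γ)
    · subst hβγ
      by_cases hδα : (δ = α)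
      · subst hδα
        simp [derE_gOne_self]
        module
      · simp [derE_gOne_self, hδα]
    · by_cases hδα : (δ = α)
      · subst hδα
        simp [derE_gOne_self, hβγ]
        module
      · simp [hδα, hβγ]

end DLRep
end

section GrassmannEuler

variable {n : ℕ}

lemma derC_mul_mulSgn_gOne_right (a : Fin n) (s : GExp n) :
    (-1 : ℂ) ^ (gdeg s + 1) * derC a s * mulSgn (derE a s) (gOne a)
      = if s a = true then 1 else 0 := by
  rw [← derC_mul_mulSgn_gOne, mulSgn_comm (derE a s), gdeg_gOne, mul_one]
  by_cases h : s a = true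
  · rw [← gdeg_derE h, add_assoc, pow_add]
    have : (-1 : ℂ) ^ gdeg (derE a s) * (-1) ^ gdeg (derE a s) = 1 := by
      rw [← mul_pow]; simp
    linear_combination (derC a s * mulSgn (gOne a) (derE a s)) * this
  · simp [derC_of_false (Bool.eq_false_of_not_eq_true h)]

lemma sum_ite_eq_gdeg (s : GExp n) : ∑ a, (if s a = true then (1 : ℂ) else 0) = gdeg s := by
  simp [gdeg]

end GrassmannEuler

noncomputable section

namespace DLRep

variable {m n : ℕ} (σ : DLRep m n true)

/-- The degree of a generator, with `t_i` and `ξ_α` of degree one, `d_i` and `∂_α` of degree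
minus one and `d_0` of degree zero. -/
def genDeg : JetGen m n → ℤ
  | ⟨s, kk, .di _⟩ => gdeg s + ∑ i, kk i - 1
  | ⟨s, kk, .pa _⟩ => gdeg s + ∑ i, kk i - 1
  | ⟨s, kk, .d0⟩ => gdeg s + ∑ i, kk i

variable {σ} in
lemma vacGen_glGen_comm (x : GlIdx m n) {g : JetGen m n} (hg : g.NotPartial) :
    σ.vacGen (glGen x x) * σ.vacGen g - σ.vacGen g * σ.vacGen (glGen x x)
      = σ.vacAct (genBr (glGen x x) g) := by
  rw [vacAct_genBr (glGen_notPartial x x) hg]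
  have : lpar ((gl0, glGen x x) : LBasis m n true) = 0 := by
    rcases x with i | α <;> simp [lpar, glGen, glExp, glDir]
  simp [this]

lemma zOf_natE_di (i : Fin m) : zOf (natE i) (.di i : Dir m n true) = 0 := by
  funext x; simp [natE]

lemma vacAct_genBr_natE_di (i j : Fin m) {s : GExp n} {kk : Fin m → ℕ}
    (h : ¬ (s = gl0 ∧ kk = 0)) :
    σ.vacAct (genBr (glGen (.inl i) (.inl i)) (s, kk, .di j))
      = ((kk i : ℂ) - if i = j then 1 else 0) • σ.vacGen (s, kk, .di j) := by
  simp only [glGen, glExp, glDeg, glDir, genBr, natE_ne_zero, false_and, if_false, zOf_natE_di]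
  split_ifs with hk hij hij
  · subst hk hij
    rw [map_smul, map_smul, map_sub, map_smul, σ.vacAct_mkL (s := xorE s gl0) (kk := 0)
        (by funext x; simp [epsZ]), σ.vacAct_mkL_of_ne (fun hs => h ⟨hs, rfl⟩)]
    simp
  · subst hk
    simp
  · subst hij
    rw [map_sub, map_smul, map_smul, σ.vacAct_mkL (kk := kk) (by simp)]
    simp
  · rw [map_sub, map_smul, map_smul, σ.vacAct_mkL (kk := kk) (by simp)]
    simp [hij]

lemma vacAct_genBr_natE_pa (i : Fin m) (β : Fin n) (s : GExp n) (kk : Fin m → ℕ) :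
    σ.vacAct (genBr (glGen (.inl i) (.inl i)) (s, kk, .pa β))
      = (kk i : ℂ) • σ.vacGen (s, kk, .pa β) := by
  simp only [glGen, glExp, glDeg, glDir, genBr, natE_ne_zero, if_false, zOf_natE_di]
  rw [map_sub, map_smul, map_smul, σ.vacAct_mkL (D := .pa β) (kk := kk) (by simp)]
  simp

lemma vacAct_genBr_natE_d0 (i : Fin m) (s : GExp n) (kk : Fin m → ℕ) :
    σ.vacAct (genBr (glGen (.inl i) (.inl i)) (s, kk, .d0))
      = (kk i : ℂ) • σ.vacGen (s, kk, .d0) := by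
  simp only [glGen, glExp, glDeg, glDir, genBr, natE_ne_zero, if_false, zOf_natE_di]
  rw [map_smul, map_smul, σ.vacAct_mkL (kk := kk) (by simp)]
  simp

lemma smul_vacGen_xorE_gOne (α : Fin n) (s : GExp n) (kk : Fin m → ℕ) (D : Dir m n true)
    (c : ℂ) (hc : c = if s α = true then 1 else 0) :
    c • σ.vacGen (xorE (gOne α) (derE α s), kk, D)
      = (if s α = true then (1 : ℂ) else 0) • σ.vacGen (s, kk, D) := by
  subst hc
  split_ifs with h
  · rw [xorE_gOne_derE h]
  · simp

lemma vacAct_genBr_gOne_di (α : Fin n) (j : Fin m) (s : GExp n) (kk : Fin m → ℕ) :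
    σ.vacAct (genBr (glGen (.inr α) (.inr α)) (s, kk, .di j))
      = (if s α = true then (1 : ℂ) else 0) • σ.vacGen (s, kk, .di j) := by
  rw [← σ.smul_vacGen_xorE_gOne α s kk (.di j) _ (derC_mul_mulSgn_gOne_right α s)]
  simp only [glGen, glExp, glDeg, glDir, genBr]
  split_ifs with hk
  · subst hk
    rw [map_smul, map_sub, map_smul, map_smul, σ.vacAct_mkL (D := .di j) (kk := 0)
      (by funext x; simp [epsZ])]
    simp [xorE_comm (derE α s)]
  · rw [map_smul, map_sub, map_smul, map_smul, map_smul, σ.vacAct_mkL (D := .di j) (kk := kk)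
      (by funext x; simp)]
    simp [xorE_comm (derE α s)]

lemma vacAct_genBr_gOne_pa (α β : Fin n) (s : GExp n) (kk : Fin m → ℕ) :
    σ.vacAct (genBr (glGen (.inr α) (.inr α)) (s, kk, .pa β))
      = ((if s α = true then (1 : ℂ) else 0) - if α = β then 1 else 0) •
          σ.vacGen (s, kk, .pa β) := by
  have h := sub_smul (if s α = true then (1 : ℂ) else 0) (if α = β then 1 else 0)
    (σ.vacGen (s, kk, .pa β))
  rw [h, ← σ.smul_vacGen_xorE_gOne α s kk (.pa β) _ (derC_mul_mulSgn_gOne α s)]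
  clear h
  simp only [glGen, glExp, glDeg, glDir, genBr]
  rw [map_sub, map_smul, map_smul, σ.vacAct_mkL (D := .pa β) (kk := kk)
      (by funext x; simp), σ.vacAct_mkL (D := .pa α) (kk := kk)
      (by funext x; simp)]
  by_cases h : α = β
  · subst h; simp
  · simp [h, Ne.symm h]

lemma vacAct_genBr_gOne_d0 (α : Fin n) (s : GExp n) (kk : Fin m → ℕ) :
    σ.vacAct (genBr (glGen (.inr α) (.inr α)) (s, kk, .d0))
      = (if s α = true then (1 : ℂ) else 0) • σ.vacGen (s, kk, .d0) := by
  rw [← σ.smul_vacGen_xorE_gOne α s kk .d0 _ (derC_mul_mulSgn_gOne α s)]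
  simp only [glGen, glExp, glDeg, glDir, genBr]
  rw [map_smul, σ.vacAct_mkL (D := .d0) (kk := kk) (by funext x; simp)]

/-- The action of the Euler vector field on the vacuum space. -/
def euler : Module.End ℂ σ.vac := ∑ x : GlIdx m n, σ.vacGen (glGen x x)

variable {σ} in
lemma euler_comm {g : JetGen m n} (hg : g.NotPartial) (hg' : ∀ i, g ≠ (gl0, 0, .di i)) :
    σ.euler * σ.vacGen g - σ.vacGen g * σ.euler = (genDeg g : ℂ) • σ.vacGen g := by
  rw [euler, Finset.sum_mul, Finset.mul_sum, ← Finset.sum_sub_distrib]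
  simp only [vacGen_glGen_comm _ hg, Fintype.sum_sum_type]
  obtain ⟨s, kk, D⟩ := g
  cases D with
  | di j =>
    have h : ¬ (s = gl0 ∧ kk = 0) := by
      rintro ⟨rfl, rfl⟩
      exact hg' j rfl
    simp only [σ.vacAct_genBr_natE_di _ j h, vacAct_genBr_gOne_di, ← Finset.sum_smul,
      ← add_smul, Finset.sum_sub_distrib, sum_ite_eq_gdeg, genDeg]
    congr 1
    simp
    ring
  | pa β =>
    simp only [vacAct_genBr_natE_pa, vacAct_genBr_gOne_pa, ← Finset.sum_smul,
      ← add_smul, Finset.sum_sub_distrib, sum_ite_eq_gdeg, genDeg]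
    congr 1
    simp
    ring
  | d0 =>
    simp only [vacAct_genBr_natE_d0, vacAct_genBr_gOne_d0, ← Finset.sum_smul,
      ← add_smul, sum_ite_eq_gdeg, genDeg]
    congr 1
    simp
    ring

end DLRep
end

noncomputable section

namespace DLRep

variable {m n : ℕ} (σ : DLRep m n true)

lemma taylorEquiv_xi_vac (c : GExp n) (v : σ.vac) :
    σ.taylorEquiv (σ.xi c v) = Finsupp.single c v := by
  rw [← taylor_single, taylorEquiv_taylor]

lemma taylorEquiv_partialOp (β : Fin n) (u : σ.U) :
    σ.taylorEquiv (σ.partialOp β u) = σ.tensorDer β (σ.taylorEquiv u) := by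
  rw [← σ.taylorEquiv_taylor (σ.tensorDer β _), taylor_tensorDer, taylor_taylorEquiv]

/-- The subspace `Λ ⊗ N` of `U` attached to a subspace `N` of the vacuum space. -/
def tensorSub (N : Submodule ℂ σ.vac) : Submodule ℂ σ.U where
  carrier := {u | ∀ c, σ.taylorEquiv u c ∈ N}
  zero_mem' c := by simp
  add_mem' hu hv c := by simpa using N.add_mem (hu c) (hv c)
  smul_mem' a u hu c := by simpa using N.smul_mem a (hu c)

variable {σ} {N : Submodule ℂ σ.vac}

lemma xi_vac_mem_tensorSub (c : GExp n) {v : σ.vac} (hv : v ∈ N) :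
    σ.xi c v ∈ σ.tensorSub N := by
  intro c'
  rw [taylorEquiv_xi_vac, Finsupp.single_apply]
  split_ifs
  · exact hv
  · exact N.zero_mem

lemma tensorSub_le {S : Submodule ℂ σ.U} (h : ∀ c, ∀ v ∈ N, σ.xi c v ∈ S) :
    σ.tensorSub N ≤ S := by
  intro u hu
  rw [← σ.taylor_taylorEquiv u]
  exact S.sum_mem fun c _ => h c _ (hu c)

lemma vac_mem_tensorSub {v : σ.vac} : (v : σ.U) ∈ σ.tensorSub N ↔ v ∈ N := by
  constructor
  · intro h
    simpa [← proj_apply] using h gl0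
  · intro h
    simpa using xi_vac_mem_tensorSub gl0 h

lemma xi_mem_tensorSub (g : GExp n) {u : σ.U} (hu : u ∈ σ.tensorSub N) :
    σ.xi g u ∈ σ.tensorSub N := by
  refine tensorSub_le (S := (σ.tensorSub N).comap (σ.xi g)) (fun c v hv => ?_) hu
  rw [Submodule.mem_comap, xi_xi]
  exact Submodule.smul_mem _ _ (xi_vac_mem_tensorSub _ hv)

lemma mem_tensorSub_of_partialOp {u : σ.U} (h : σ.proj u ∈ N)
    (h' : ∀ β, σ.partialOp β u ∈ σ.tensorSub N) : u ∈ σ.tensorSub N := by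
  intro c
  by_cases hc : c = gl0
  · subst hc
    exact h
  · obtain ⟨β, hβ⟩ := exists_eq_true_of_ne_gl0 hc
    have := h' β (derE β c)
    rw [taylorEquiv_partialOp, tensorDer_apply_derE _ _ _ hβ] at this
    exact (N.smul_mem_iff (derC_ne_zero hβ)).mp this

lemma gen_vac_mem_tensorSub (hN : ∀ g, ∀ v ∈ N, σ.vacGen g v ∈ N) (s : GExp n)
    (kk : Fin m → ℕ) (D : Dir m n true) {v : σ.vac} (hv : v ∈ N) :
    σ.gen (s, kk, D) v ∈ σ.tensorSub N := by
  induction hd : gdeg s generalizing s with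
  | zero =>
    refine mem_tensorSub_of_partialOp (hN _ v hv) fun β => ?_
    rw [partialOp_gen, (gdeg_eq_zero_iff s).mp hd, derC_gl0, zero_smul]
    exact Submodule.zero_mem _
  | succ d ih =>
    refine mem_tensorSub_of_partialOp (hN _ v hv) fun β => ?_
    rw [partialOp_gen]
    by_cases h : s β = true
    · refine Submodule.smul_mem _ _ (ih _ ?_)
      have := gdeg_derE h
      omega
    · rw [derC_of_false (Bool.eq_false_of_not_eq_true h), zero_smul]
      exact Submodule.zero_mem _

lemma lact_genOnL_mem {S : Submodule ℂ σ.U} (g : JetGen m n) (c : GExp n) {u : σ.U}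
    (h : ∀ s, σ.xi s u ∈ S) : σ.lact (genOnL g c) u ∈ S := by
  obtain ⟨s, kk, D⟩ := g
  cases D with
  | di i => simp [genOnL]
  | d0 => simp [genOnL]
  | pa α =>
    simp only [genOnL]
    split_ifs
    · rw [map_smul]
      exact S.smul_mem _ (h _)
    · simp

lemma gen_mem_tensorSub (hN : ∀ g, ∀ v ∈ N, σ.vacGen g v ∈ N) (g : JetGen m n) {u : σ.U}
    (hu : u ∈ σ.tensorSub N) : σ.gen g u ∈ σ.tensorSub N := by
  refine tensorSub_le (S := (σ.tensorSub N).comap (σ.gen g)) (fun c v hv => ?_) hu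
  rw [Submodule.mem_comap, gen_xi]
  exact Submodule.add_mem _
    (lact_genOnL_mem g c fun s => xi_vac_mem_tensorSub s hv)
    (Submodule.smul_mem _ _ (xi_mem_tensorSub c (gen_vac_mem_tensorSub hN _ _ _ hv)))

lemma eq_bot_or_eq_top_of_vacGen (hσ : σ.IsSimple) (hN : ∀ g, ∀ v ∈ N, σ.vacGen g v ∈ N) :
    N = ⊥ ∨ N = ⊤ := by
  rcases hσ.2 (σ.tensorSub N)
    (fun x u hu => by
      rw [← Prod.mk.eta (p := x), act_lsng]
      exact xi_mem_tensorSub _ (gen_mem_tensorSub hN _ hu))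
    (fun f u hu => xi_mem_tensorSub f hu) with h | h
  · refine Or.inl ((Submodule.eq_bot_iff _).mpr fun v hv => ?_)
    rw [← vac_mem_tensorSub, h, Submodule.mem_bot] at hv
    exact Subtype.ext hv
  · refine Or.inr ((Submodule.eq_top_iff').mpr fun v => ?_)
    rw [← vac_mem_tensorSub, h]
    exact Submodule.mem_top

lemma exists_vac_ne_zero (hσ : σ.IsSimple) : ∃ v : σ.vac, v ≠ 0 := by
  by_contra! h
  obtain ⟨u, hu⟩ := hσ.1
  refine hu (σ.taylorEquiv.injective ?_)
  ext c
  simp [h]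

/-! ### Vanishing of the generators of positive degree -/

lemma exists_maximal_eigenvalue {M : Type*} [AddCommGroup M] [Module ℂ M]
    [FiniteDimensional ℂ M] [Nontrivial M] (E : Module.End ℂ M) :
    ∃ μ : ℂ, E.HasEigenvalue μ ∧ ∀ d : ℤ, 0 < d → ¬ E.HasEigenvalue (μ + d) := by
  obtain ⟨μ₀, hμ₀⟩ := Module.End.exists_eigenvalue E
  obtain ⟨μ, hμ, hmax⟩ := Set.exists_max_image {μ | E.HasEigenvalue μ} Complex.re
    (Module.End.finite_hasEigenvalue E) ⟨μ₀, hμ₀⟩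
  refine ⟨μ, hμ, fun d hd h => ?_⟩
  have := hmax _ h
  have hd' : (0 : ℝ) < d := by exact_mod_cast hd
  simp at this
  linarith

end DLRep
end

noncomputable section

namespace DLRep

variable {m n : ℕ} {σ : DLRep m n true}

lemma genDeg_nonneg {g : JetGen m n} (hg : g.NotPartial) (hg' : ∀ i, g ≠ (gl0, 0, .di i)) :
    0 ≤ genDeg g := by
  obtain ⟨s, kk, D⟩ := g
  have key : ¬ (s = gl0 ∧ kk = 0) → (1 : ℤ) ≤ gdeg s + (∑ i, kk i : ℕ) := by
    intro h
    by_contra! hlt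
    have h0 : gdeg s + ∑ i, kk i = 0 := by
      have : ((gdeg s + ∑ i, kk i : ℕ) : ℤ) < 1 := by rw [Nat.cast_add]; exact hlt
      omega
    refine h ⟨(gdeg_eq_zero_iff s).mp (by omega), ?_⟩
    have h1 : ∑ i, kk i = 0 := by omega
    funext i
    exact Finset.sum_eq_zero_iff.mp h1 i (Finset.mem_univ i)
  cases D with
  | di j =>
    have := key (by rintro ⟨rfl, rfl⟩; exact hg' j rfl)
    simp only [genDeg]
    omega
  | pa β =>
    have := key (by rintro ⟨rfl, rfl⟩; exact hg β rfl)
    simp only [genDeg]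
    omega
  | d0 =>
    simp only [genDeg]
    positivity

lemma vacGen_eq_zero_of_genDeg_pos [FiniteDimensional ℂ σ.U] (hσ : σ.IsSimple)
    (hc : ∀ i, ∃ c : ℂ, σ.vacGen (gl0, 0, .di i) = c • 1) {g : JetGen m n}
    (hg : 0 < genDeg g) : σ.vacGen g = 0 := by
  obtain ⟨v₀, hv₀⟩ := exists_vac_ne_zero hσ
  have : Nontrivial σ.vac := ⟨v₀, 0, hv₀⟩
  obtain ⟨μ, hμ, hmax⟩ := exists_maximal_eigenvalue σ.euler
  have hsub : ∀ {g : JetGen m n}, g.NotPartial → (∀ i, g ≠ (gl0, 0, .di i)) →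
      ∀ v ∈ σ.euler.eigenspace μ,
        σ.vacGen g v ∈ σ.euler.eigenspace (μ + genDeg g) := by
    intro g hg hg' v hv
    rw [Module.End.mem_eigenspace_iff] at hv ⊢
    have h := LinearMap.congr_fun (euler_comm hg hg') v
    change σ.euler (σ.vacGen g v) - σ.vacGen g (σ.euler v) = (genDeg g : ℂ) • σ.vacGen g v at h
    rw [hv, map_smul, sub_eq_iff_eq_add] at h
    rw [h, add_smul, add_comm]
  have hpos : ∀ {g : JetGen m n}, 0 < genDeg g → ∀ v ∈ σ.euler.eigenspace μ,
      σ.vacGen g v = 0 := by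
    intro g hg v hv
    by_contra hne
    refine hmax _ hg (Module.End.hasEigenvalue_of_hasEigenvector ⟨hsub ?_ ?_ v hv, hne⟩)
    · rintro β rfl
      simp [genDeg] at hg
    · rintro i rfl
      simp [genDeg] at hg
  have hstab : ∀ g, ∀ v ∈ σ.euler.eigenspace μ, σ.vacGen g v ∈ σ.euler.eigenspace μ := by
    intro g v hv
    by_cases hg : g.NotPartial
    · by_cases hg' : ∀ i, g ≠ (gl0, 0, .di i)
      · rcases (genDeg_nonneg hg hg').lt_or_eq with h | h
        · rw [hpos h v hv]
          exact Submodule.zero_mem _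
        · simpa [← h] using hsub hg hg' v hv
      · push Not at hg'
        obtain ⟨i, rfl⟩ := hg'
        obtain ⟨c, h⟩ := hc i
        rw [h]
        exact Submodule.smul_mem _ c hv
    · simp only [JetGen.NotPartial, not_forall, not_not] at hg
      obtain ⟨β, rfl⟩ := hg
      rw [vacGen_partial]
      exact Submodule.zero_mem _
  rcases eq_bot_or_eq_top_of_vacGen hσ hstab with h | h
  · exact absurd h hμ
  · ext v
    rw [hpos hg v (h ▸ Submodule.mem_top)]
    rfl

lemma proj_xi_vac (c : GExp n) (v : σ.vac) :
    σ.proj (σ.xi c v) = if c = gl0 then v else 0 := by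
  split_ifs with h
  · subst h; simp
  · exact σ.proj_xi h _

lemma gen_vac (h2 : ∀ s kk D, 2 ≤ gdeg s → σ.vacGen (s, kk, D) = 0) (f : GExp n)
    (kk : Fin m → ℕ) (D : Dir m n true) (v : σ.vac) :
    σ.gen (f, kk, D) v
      = σ.xi f (σ.vacGen (gl0, kk, D) v)
        + ∑ α, ((-1 : ℂ) ^ (gdeg f + 1) * derC α f) •
            σ.xi (derE α f) (σ.vacGen (gOne α, kk, D) v) := by
  induction hd : gdeg f using Nat.strong_induction_on generalizing f with
  | _ d ih =>
  subst hd
  rw [← sub_eq_zero]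
  apply eq_zero_of_proj_of_partialOp
  · simp only [map_sub, map_add, map_sum, map_smul, proj_xi_vac, ← vacGen_apply]
    by_cases hf : f = gl0
    · subst hf; simp
    obtain ⟨α, hα⟩ := exists_eq_true_of_ne_gl0 hf
    by_cases hd : derE α f = gl0
    · obtain rfl : f = gOne α := by
        rw [← xorE_gOne_derE hα, hd, xorE_gl0_right]
      rw [if_neg hf, Finset.sum_eq_single α]
      · simp
      · intro β _ hβ
        simp [hβ]
      · simp
    · have hf2 : 2 ≤ gdeg f := by
        have h1 := gdeg_derE hα
        have h3 := mt (gdeg_eq_zero_iff _).mp hd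
        omega
      rw [h2 _ _ _ hf2, if_neg hf, Finset.sum_eq_zero]
      · simp
      · intro β _
        by_cases hβ : f β = true
        · rw [if_neg, smul_zero]
          intro h
          have h1 := gdeg_derE hβ
          rw [h, gdeg_gl0] at h1
          omega
        · simp [derC_of_false (Bool.eq_false_of_not_eq_true hβ)]
  · intro β
    simp only [map_sub, map_add, map_sum, map_smul, partialOp_gen, partialOp_xi, partialOp_vac,
      map_zero, smul_zero, add_zero]
    have hL : derC β f • σ.gen (derE β f, kk, D) v
        = derC β f • σ.xi (derE β f) (σ.vacGen (gl0, kk, D) v)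
          + ∑ α, ((-1 : ℂ) ^ gdeg f * (derC β f * derC α (derE β f))) •
              σ.xi (derE α (derE β f)) (σ.vacGen (gOne α, kk, D) v) := by
      by_cases hβ : f β = true
      · have h1 := gdeg_derE hβ
        rw [ih _ (by omega) _ rfl, smul_add, Finset.smul_sum]
        congr 1
        refine Finset.sum_congr rfl fun α _ => ?_
        rw [smul_smul, h1]
        congr 1
        ring
      · simp [derC_of_false (Bool.eq_false_of_not_eq_true hβ)]
    rw [hL, sub_eq_zero]
    congr 1
    refine Finset.sum_congr rfl fun α _ => ?_
    rw [smul_smul, derE_comm, derC_mul_derC]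
    congr 1
    ring

end DLRep
end

section Exponents

variable {m n : ℕ}

lemma eq_zero_or_natE (kk : Fin m → ℕ) : kk = 0 ∨ (∃ i, kk = natE i) ∨ 2 ≤ ∑ i, kk i := by
  by_cases h : kk = 0
  · exact Or.inl h
  obtain ⟨i, hi⟩ := Function.ne_iff.mp h
  have hsum := Finset.add_sum_erase Finset.univ kk (Finset.mem_univ i)
  by_cases h2 : 2 ≤ ∑ i, kk i
  · exact Or.inr (Or.inr h2)
  have hi' : kk i ≠ 0 := hi
  refine Or.inr (Or.inl ⟨i, funext fun x => ?_⟩)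
  by_cases hx : x = i
  · subst hx
    simp only [natE, if_true]
    omega
  · have h0 : ∑ x ∈ Finset.univ.erase i, kk x = 0 := by omega
    simpa [natE, hx] using
      Finset.sum_eq_zero_iff.mp h0 x (Finset.mem_erase.mpr ⟨hx, Finset.mem_univ x⟩)

lemma eq_gl0_or_gOne (s : GExp n) : s = gl0 ∨ (∃ α, s = gOne α) ∨ 2 ≤ gdeg s := by
  by_cases h : s = gl0
  · exact Or.inl h
  obtain ⟨α, hα⟩ := exists_eq_true_of_ne_gl0 h
  have h1 := gdeg_derE hα
  by_cases hd : derE α s = gl0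
  · refine Or.inr (Or.inl ⟨α, ?_⟩)
    rw [← xorE_gOne_derE hα, hd, xorE_gl0_right]
  · have := mt (gdeg_eq_zero_iff _).mp hd
    exact Or.inr (Or.inr (by omega))

lemma sum_natE (i : Fin m) : ∑ x, natE i x = 1 := by simp [natE]

lemma sum_jet_coeff_smul {M : Type*} [AddCommGroup M] [Module ℂ M] (r : LExp m)
    (T : (Fin m → ℕ) → M) (hT : ∀ kk, 2 ≤ ∑ i, kk i → T kk = 0) :
    ∑ k : Fin m → Fin (1 + 1),
        ((∏ i, (r i : ℂ) ^ (k i : ℕ)) / (∏ i, ((Nat.factorial (k i)) : ℂ))) •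
          T (fun i => (k i : ℕ))
      = T 0 + ∑ i, (r i : ℂ) • T (natE i) := by
  let e : Option (Fin m) → Fin m → Fin (1 + 1) := fun o =>
    o.elim 0 fun i x => if x = i then 1 else 0
  have he0 : (fun i => ((e none i : Fin (1 + 1)) : ℕ)) = 0 := rfl
  have he1 : ∀ i, (fun x => ((e (some i) x : Fin (1 + 1)) : ℕ)) = natE i := by
    intro i
    funext x
    by_cases h : x = i <;> simp [e, natE, h]
  have hval : ∀ {k k' : Fin m → Fin (1 + 1)},
      (fun i => (k i : ℕ)) = (fun i => (k' i : ℕ)) → k = k' := fun h =>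
    funext fun i => Fin.ext (congrFun h i)
  have hinj : Function.Injective e := by
    rintro (_ | i) (_ | j) h
    · rfl
    · have := he1 j
      rw [← h, he0] at this
      exact absurd this.symm (fun h' => by simpa [natE] using congrFun h' j)
    · have := he1 i
      rw [h, he0] at this
      exact absurd this.symm (fun h' => by simpa [natE] using congrFun h' i)
    · have := he1 i
      rw [h, he1] at this
      have := congrFun this j
      by_cases hij : j = i
      · rw [hij]
      · simp [natE, hij] at this
  rw [← Fintype.sum_of_injective e hinj
    (fun o => o.elim (T 0) fun i => (r i : ℂ) • T (natE i)) _ _ _, Fintype.sum_option]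
  · rfl
  · intro k hk
    rcases eq_zero_or_natE fun i => (k i : ℕ) with h | ⟨i, h⟩ | h
    · exact absurd ⟨none, hval (he0.trans h.symm)⟩ hk
    · exact absurd ⟨some i, hval ((he1 i).trans h.symm)⟩ hk
    · rw [hT _ h, smul_zero]
  · rintro (_ | i)
    · simp [e]
      rfl
    · have h1 : ∀ x, ((e (some i) x : Fin (1 + 1)) : ℕ) = natE i x := congrFun (he1 i)
      simp only [h1]
      have h2 : ∀ x, (natE i x).factorial = 1 := by
        intro x
        by_cases h : x = i <;> simp [natE, h]
      have h3 : ∏ x, (r x : ℂ) ^ natE i x = r i := by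
        simp [natE, pow_ite]
      simp [h2, h3]

end Exponents

noncomputable section

lemma glTensorOp_eq_sum {m n : ℕ} (V : GlRep m n) (lam : Fin m → ℂ) (lam0 : ℂ)
    (D : Dir m n true) (f : GExp n) (r : LExp m) (u : GExp n →₀ V.V) :
    glTensorOp V lam lam0 D f r u
      = u.sum fun c v => glTensorOp V lam lam0 D f r (Finsupp.single c v) := by
  cases D <;> simp only [glTensorOp] <;>
    exact Finsupp.sum_congr fun c _ => by rw [Finsupp.sum_single_index (by simp)]

lemma glTensorOp_di_single {m n : ℕ} (V : GlRep m n) (lam : Fin m → ℂ) (lam0 : ℂ) (j : Fin m)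
    (f c : GExp n) (r : LExp m) (v : V.V) :
    glTensorOp V lam lam0 (.di j) f r (Finsupp.single c v)
      = (lam j * mulSgn f c) • Finsupp.single (xorE f c) v
        + ∑ i, ((r i : ℂ) * mulSgn f c) • Finsupp.single (xorE f c) (V.ρ (.inl i) (.inl j) v)
        + ∑ α, ((-1 : ℂ) ^ gdeg c * ((-1 : ℂ) ^ (gdeg f + 1) * derC α f) *
            mulSgn (derE α f) c) • Finsupp.single (xorE (derE α f) c)
              (V.ρ (.inr α) (.inl j) v) := by
  simp only [glTensorOp]
  rw [Finsupp.sum_single_index (by simp)]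

lemma glTensorOp_pa_single {m n : ℕ} (V : GlRep m n) (lam : Fin m → ℂ) (lam0 : ℂ) (β : Fin n)
    (f c : GExp n) (r : LExp m) (v : V.V) :
    glTensorOp V lam lam0 (.pa β) f r (Finsupp.single c v)
      = (derC β c * mulSgn f (derE β c)) • Finsupp.single (xorE f (derE β c)) v
        + ∑ i, ((-1 : ℂ) ^ gdeg c * (r i : ℂ) * mulSgn f c) •
            Finsupp.single (xorE f c) (V.ρ (.inl i) (.inr β) v)
        + ∑ α, (((-1 : ℂ) ^ (gdeg f + 1) * derC α f) * mulSgn (derE α f) c) •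
            Finsupp.single (xorE (derE α f) c) (V.ρ (.inr α) (.inr β) v) := by
  simp only [glTensorOp]
  rw [Finsupp.sum_single_index (by simp)]

lemma glTensorOp_d0_single {m n : ℕ} (V : GlRep m n) (lam : Fin m → ℂ) (lam0 : ℂ)
    (f c : GExp n) (r : LExp m) (v : V.V) :
    glTensorOp V lam lam0 .d0 f r (Finsupp.single c v)
      = (lam0 * mulSgn f c) • Finsupp.single (xorE f c) v := by
  simp only [glTensorOp]
  rw [Finsupp.sum_single_index (by simp)]

namespace DLRep

variable {m n : ℕ} (σ : DLRep m n true)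

/-- The vacuum space as a `gl(m,n)`-module. -/
def vacGlRep : GlRep m n where
  V := σ.vac
  ρ x y := σ.vacGen (glGen x y)
  rel := σ.vacGen_glGen_rel

/-- The parity of a direction. -/
def dirPar : Dir m n true → ℕ
  | .pa _ => 1
  | _ => 0

lemma neg_one_pow_lpar (f : GExp n) (kk : Fin m → ℕ) (D : Dir m n true) (d : ℕ) :
    (-1 : ℂ) ^ (lpar ((gl0, f, kk, D) : LBasis m n true) * d)
      = (-1) ^ ((gdeg f + dirPar D) * d) := by
  cases D <;> simp [lpar, dirPar, neg_one_pow_mod_two_mul]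

variable {σ}

lemma taylorEquiv_xi_xi_vac (c f : GExp n) (v : σ.vac) :
    σ.taylorEquiv (σ.xi c (σ.xi f v))
      = ((-1 : ℂ) ^ (gdeg f * gdeg c) * mulSgn f c) • Finsupp.single (xorE f c) v := by
  rw [xi_xi_comm, xi_xi, map_smul, map_smul, taylorEquiv_xi_vac, smul_smul, mul_comm (gdeg c)]

lemma taylorEquiv_gen_xi_vac (h2 : ∀ s kk D, 2 ≤ gdeg s → σ.vacGen (s, kk, D) = 0)
    (f c : GExp n) (kk : Fin m → ℕ) (D : Dir m n true) (v : σ.vac) :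
    σ.taylorEquiv (σ.gen (f, kk, D) (σ.xi c v))
      = σ.taylorEquiv (σ.lact (genOnL (f, kk, D) c) v)
        + (((-1 : ℂ) ^ (dirPar D * gdeg c) * mulSgn f c) •
            Finsupp.single (xorE f c) (σ.vacGen (gl0, kk, D) v)
          + ∑ α, ((-1 : ℂ) ^ ((dirPar D + 1) * gdeg c) * ((-1 : ℂ) ^ (gdeg f + 1) * derC α f) *
              mulSgn (derE α f) c) •
              Finsupp.single (xorE (derE α f) c) (σ.vacGen (gOne α, kk, D) v)) := by
  have hsq : ∀ d : ℕ, (-1 : ℂ) ^ d * (-1) ^ d = 1 := fun d => by rw [← mul_pow]; simp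
  rw [gen_xi, map_add, gen_vac h2, neg_one_pow_lpar]
  congr 1
  simp only [map_smul, map_add, map_sum, taylorEquiv_xi_xi_vac, smul_add, Finset.smul_sum,
    smul_smul]
  congr 1
  · congr 1
    rw [add_mul, pow_add]
    linear_combination ((-1 : ℂ) ^ (dirPar D * gdeg c) * mulSgn f c) * hsq (gdeg f * gdeg c)
  · refine Finset.sum_congr rfl fun α _ => ?_
    congr 1
    by_cases hα : f α = true
    · rw [← gdeg_derE hα, show (gdeg (derE α f) + 1 + dirPar D) * gdeg c
        = gdeg (derE α f) * gdeg c + (dirPar D + 1) * gdeg c by ring, pow_add]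
      linear_combination ((-1 : ℂ) ^ ((dirPar D + 1) * gdeg c) *
        ((-1 : ℂ) ^ (gdeg (derE α f) + 1 + 1) * derC α f) * mulSgn (derE α f) c) *
          hsq (gdeg (derE α f) * gdeg c)
    · simp [derC_of_false (Bool.eq_false_of_not_eq_true hα)]

lemma vacGen_mem_of_glGen {N : Submodule ℂ σ.vac}
    (hpos : ∀ g : JetGen m n, 0 < genDeg g → σ.vacGen g = 0)
    (hdi : ∀ i, ∃ c : ℂ, σ.vacGen (gl0, 0, .di i) = c • 1)
    (hd0 : ∃ c : ℂ, σ.vacGen (gl0, 0, .d0) = c • 1)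
    (hN : ∀ x y, ∀ v ∈ N, σ.vacGen (glGen x y) v ∈ N) (g : JetGen m n) :
    ∀ v ∈ N, σ.vacGen g v ∈ N := by
  intro v hv
  have hscal : ∀ {g : JetGen m n}, (∃ c : ℂ, σ.vacGen g = c • 1) → σ.vacGen g v ∈ N := by
    rintro g ⟨c, h⟩
    rw [h]
    exact N.smul_mem c hv
  have hzero : 0 < genDeg g → σ.vacGen g v ∈ N := fun h => by
    rw [hpos g h]
    exact N.zero_mem
  obtain ⟨s, kk, D⟩ := g
  have hD : (D = .d0 ∨ ∃ y, D = glDir y) := by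
    cases D with
    | di j => exact Or.inr ⟨.inl j, rfl⟩
    | pa β => exact Or.inr ⟨.inr β, rfl⟩
    | d0 => exact Or.inl rfl
  by_cases h2 : 2 ≤ gdeg s + ∑ i, kk i
  · apply hzero
    zify at h2
    cases D <;> simp only [genDeg] <;> push_cast <;> linarith
  rcases eq_gl0_or_gOne s with rfl | ⟨α, rfl⟩ | h
  · rcases eq_zero_or_natE kk with rfl | ⟨i, rfl⟩ | h
    · cases D with
      | di j => exact hscal (hdi j)
      | pa β =>
        rw [vacGen_partial]
        exact N.zero_mem
      | d0 => exact hscal hd0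
    · rcases hD with rfl | ⟨y, rfl⟩
      · apply hzero
        simp [genDeg, sum_natE]
      · exact hN (.inl i) y v hv
    · omega
  · rcases eq_zero_or_natE kk with rfl | ⟨i, rfl⟩ | h
    · rcases hD with rfl | ⟨y, rfl⟩
      · apply hzero
        simp [genDeg]
      · exact hN (.inr α) y v hv
    · rw [gdeg_gOne, sum_natE] at h2
      omega
    · omega
  · omega

lemma sum_taylorEquiv_gen (hpos : ∀ g : JetGen m n, 0 < genDeg g → σ.vacGen g = 0)
    {lam : Fin m → ℂ} {lam0 : ℂ} (hdi : ∀ i, σ.vacGen (gl0, 0, .di i) = lam i • 1)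
    (hd0 : σ.vacGen (gl0, 0, .d0) = lam0 • 1)
    (D : Dir m n true) (f c : GExp n) (r : LExp m) (v : σ.vac) :
    ∑ k : Fin m → Fin (1 + 1),
        ((∏ i, (r i : ℂ) ^ (k i : ℕ)) / (∏ i, ((Nat.factorial (k i)) : ℂ))) •
          σ.taylorEquiv (σ.gen (f, fun i => (k i : ℕ), D) (σ.xi c v))
      = glTensorOp σ.vacGlRep lam lam0 D f r (Finsupp.single c v) := by
  have hdeg : ∀ s kk (D : Dir m n true), 2 ≤ gdeg s + ∑ i, kk i → σ.vacGen (s, kk, D) = 0 := by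
    intro s kk D h
    apply hpos
    zify at h
    cases D <;> simp only [genDeg] <;> push_cast <;> linarith
  have h2 : ∀ s kk D, 2 ≤ gdeg s → σ.vacGen (s, kk, D) = 0 := fun s kk D h =>
    hdeg s kk D (by omega)
  have h1 : ∀ α i (D : Dir m n true), σ.vacGen (gOne α, natE i, D) = 0 := fun α i D =>
    hdeg _ _ _ (by rw [gdeg_gOne, sum_natE])
  rw [sum_jet_coeff_smul r (fun kk => σ.taylorEquiv (σ.gen (f, kk, D) (σ.xi c v)))]
  · simp only [taylorEquiv_gen_xi_vac h2, h1]
    cases D with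
    | di j =>
      refine Eq.trans ?_ (glTensorOp_di_single σ.vacGlRep lam lam0 j f c r v).symm
      show _ = (lam j * mulSgn f c) • Finsupp.single (xorE f c) v
        + ∑ i, ((r i : ℂ) * mulSgn f c) •
            Finsupp.single (xorE f c) (σ.vacGen (gl0, natE i, .di j) v)
        + ∑ α, ((-1 : ℂ) ^ gdeg c * ((-1 : ℂ) ^ (gdeg f + 1) * derC α f) *
            mulSgn (derE α f) c) • Finsupp.single (xorE (derE α f) c)
              (σ.vacGen (gOne α, 0, .di j) v)
      simp only [genOnL, hdi, dirPar]
      simp [smul_smul]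
      rw [add_right_comm, mul_comm (lam j)]
    | pa β =>
      refine Eq.trans ?_ (glTensorOp_pa_single σ.vacGlRep lam lam0 β f c r v).symm
      show _ = (derC β c * mulSgn f (derE β c)) • Finsupp.single (xorE f (derE β c)) v
        + ∑ i, ((-1 : ℂ) ^ gdeg c * (r i : ℂ) * mulSgn f c) •
            Finsupp.single (xorE f c) (σ.vacGen (gl0, natE i, .pa β) v)
        + ∑ α, (((-1 : ℂ) ^ (gdeg f + 1) * derC α f) * mulSgn (derE α f) c) •
            Finsupp.single (xorE (derE α f) c) (σ.vacGen (gOne α, 0, .pa β) v)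
      simp only [genOnL, dirPar, vacGen_partial, natE_ne_zero]
      simp [smul_smul]
      rw [add_right_comm, ← xi, taylorEquiv_xi_vac, Finsupp.smul_single]
      simp only [mul_comm ((r _ : ℂ)), mul_right_comm ((-1 : ℂ) ^ _) _ (mulSgn _ _)]
    | d0 =>
      refine Eq.trans ?_ (glTensorOp_d0_single σ.vacGlRep lam lam0 f c r v).symm
      show _ = (lam0 * mulSgn f c) • Finsupp.single (xorE f c) v
      have h01 : ∀ i, σ.vacGen (gl0, natE i, .d0) = 0 := fun i =>
        hpos _ (by simp [genDeg, sum_natE])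
      have h10 : ∀ α, σ.vacGen (gOne α, 0, .d0) = 0 := fun α => hpos _ (by simp [genDeg])
      simp only [genOnL, hd0, dirPar, h01, h10]
      simp [smul_smul, mul_comm]
  · intro kk hkk
    have hk0 : kk ≠ 0 := by
      rintro rfl
      simp at hkk
    have hg : genOnL (f, kk, D) c = 0 := by
      cases D <;> simp [genOnL, hk0]
    rw [taylorEquiv_gen_xi_vac h2, hg, hdeg gl0 kk D (by omega)]
    simp only [hdeg _ kk D (le_add_left hkk)]
    simp

end DLRep
end

noncomputable section
namespace DLRep

variable {m n : ℕ} {σ : DLRep m n true}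

lemma vacGen_eq_smul_one {g : JetGen m n} {c : ℂ}
    (h : σ.act (lsng (gl0, g)) = c • (LinearMap.id : σ.U →ₗ[ℂ] σ.U)) :
    σ.vacGen g = c • 1 := by
  ext v
  rw [vacGen_apply, gen, h]
  simp

lemma vacGlRep_isSimple [FiniteDimensional ℂ σ.U] (hσ : σ.IsSimple)
    (hdi : ∀ i, ∃ c : ℂ, σ.vacGen (gl0, 0, .di i) = c • 1)
    (hd0 : ∃ c : ℂ, σ.vacGen (gl0, 0, .d0) = c • 1) : σ.vacGlRep.IsSimple :=
  ⟨exists_vac_ne_zero hσ, fun _ hN => eq_bot_or_eq_top_of_vacGen hσ fun g =>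
    vacGen_mem_of_glGen (fun _ => vacGen_eq_zero_of_genDeg_pos hσ hdi) hdi hd0 hN g⟩

lemma sum_taylorEquiv_gen_taylor (hpos : ∀ g : JetGen m n, 0 < genDeg g → σ.vacGen g = 0)
    {lam : Fin m → ℂ} {lam0 : ℂ} (hdi : ∀ i, σ.vacGen (gl0, 0, .di i) = lam i • 1)
    (hd0 : σ.vacGen (gl0, 0, .d0) = lam0 • 1)
    (D : Dir m n true) (f : GExp n) (r : LExp m) (u : GExp n →₀ σ.vac) :
    ∑ k : Fin m → Fin (1 + 1),
        ((∏ i, (r i : ℂ) ^ (k i : ℕ)) / (∏ i, ((Nat.factorial (k i)) : ℂ))) •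
          σ.taylorEquiv (σ.gen (f, fun i => (k i : ℕ), D) (σ.taylor u))
      = glTensorOp σ.vacGlRep lam lam0 D f r u := by
  let T : (GExp n →₀ σ.vac) →ₗ[ℂ] (GExp n →₀ σ.vac) :=
    ∑ k : Fin m → Fin (1 + 1),
      ((∏ i, (r i : ℂ) ^ (k i : ℕ)) / (∏ i, ((Nat.factorial (k i)) : ℂ))) •
        (σ.taylorEquiv.toLinearMap ∘ₗ σ.gen (f, fun i => (k i : ℕ), D) ∘ₗ σ.taylor)
  have hT : ∀ w, T w = ∑ k : Fin m → Fin (1 + 1),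
      ((∏ i, (r i : ℂ) ^ (k i : ℕ)) / (∏ i, ((Nat.factorial (k i)) : ℂ))) •
        σ.taylorEquiv (σ.gen (f, fun i => (k i : ℕ), D) (σ.taylor w)) := fun w => by
    simp [T]
  rw [← hT]
  refine Eq.trans ?_ (glTensorOp_eq_sum σ.vacGlRep lam lam0 D f r u).symm
  conv_lhs => rw [← Finsupp.sum_single u, map_finsuppSum]
  refine Finsupp.sum_congr fun c _ => ?_
  rw [hT, taylor_single]
  exact sum_taylorEquiv_gen hpos hdi hd0 D f c r (u c)

end DLRep
end

/-- Let `U` be a simple finite-dimensional module for `D(Λ,L)`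
on which the central operators `d_i(1,−ε_i)` act as scalars `λ_i · Id` with
`λ ≠ 0`, and `d_0(1,0)` acts as `λ_0 · Id`.  Then there is a finite-dimensional
irreducible `gl(m,n)`-module `(V,ρ)` with `U ≅ Λ ⊗ V` (compatibly with the
`Λ`-actions), and the `L`-action integrates to the action of `(A#V)_0` on
`Λ ⊗ V` given by
`D_j(f,s) = λ_j f ⊗ Id + Σ_i s_i f ⊗ ρ(e_{ij}) + Σ_α (f)∂*_α ⊗ ρ(e_{αj})`,
`Δ_β(f,s) = f ∂/∂ξ_β ⊗ Id + Σ_i s_i f ⊗ ρ(e_{iβ}) + Σ_α (f)∂*_α ⊗ ρ(e_{αβ})`,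
`D_0(f,s) = λ_0 f ⊗ Id`. -/
theorem simple_DL_module_is_tensor (m n : ℕ) (σ : DLRep m n true)
    (hfin : FiniteDimensional ℂ σ.U) (hsimple : σ.IsSimple)
    (lam : Fin m → ℂ) (lam0 : ℂ)
    (hcent : ∀ i : Fin m,
      σ.act (lsng (gl0, gl0, 0, .di i)) = lam i • (LinearMap.id : σ.U →ₗ[ℂ] σ.U))
    (hlam : lam ≠ 0)
    (hcent0 : σ.act (lsng (gl0, gl0, 0, .d0)) = lam0 • (LinearMap.id : σ.U →ₗ[ℂ] σ.U)) :
    ∃ V : GlRep m n, FiniteDimensional ℂ V.V ∧ V.IsSimple ∧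
      ∃ φ : σ.U ≃ₗ[ℂ] (GExp n →₀ V.V),
        -- `U ≅ Λ ⊗ V` as `Λ`-modules
        (∀ (g : GExp n) (u : σ.U), φ (σ.lact (lm g) u) = lmulTV g (φ u)) ∧
        -- the `L`-action integrates to the stated `(A#V)_0`-action on `Λ ⊗ V`
        (∃ N : ℕ, ∀ (D : Dir m n true) (f : GExp n) (r : LExp m)
            (u : GExp n →₀ V.V),
          (∑ k : Fin m → Fin (N + 1),
              ((∏ i, (r i : ℂ) ^ (k i : ℕ)) /
                  (∏ i, ((Nat.factorial (k i)) : ℂ))) •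
                φ (σ.act (lsng (gl0, f, fun i => (k i : ℕ), D)) (φ.symm u)))
            = glTensorOp V lam lam0 D f r u) := by
  have hdi : ∀ i, σ.vacGen (gl0, 0, .di i) = lam i • 1 := fun i =>
    DLRep.vacGen_eq_smul_one (hcent i)
  have hd0 : σ.vacGen (gl0, 0, .d0) = lam0 • 1 := DLRep.vacGen_eq_smul_one hcent0
  have hdi' : ∀ i, ∃ c : ℂ, σ.vacGen (gl0, 0, .di i) = c • 1 := fun i => ⟨_, hdi i⟩
  exact ⟨σ.vacGlRep, inferInstanceAs (FiniteDimensional ℂ σ.vac),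
    DLRep.vacGlRep_isSimple hsimple hdi' ⟨_, hd0⟩, σ.taylorEquiv, σ.taylorEquiv_xi, 1,
    fun D f r u => DLRep.sum_taylorEquiv_gen_taylor
      (fun _ => DLRep.vacGen_eq_zero_of_genDeg_pos hsimple hdi') hdi hd0 D f r u⟩

end WSuper
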